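/- arXiv:1409.7795 — 12 statements merged into one kernel-verified Lean document; each statement's English description precedes it below -/
import Mathlib

section
/- For every integer r ≥ 1, a tree T on n vertices has exactly n r-matchings if and only if the diameter of T is at most r+1. -/
open SimpleGraph Filter

/-- The distance between two edges `e, f` of a graph `G`: the minimum distance between
a vertex incident to `e` and a vertex incident to `f`. -/
noncomputable def edgeDist {V : Type*} (G : SimpleGraph V) (e f : Sym2 V) : ℕ :=
  sInf {d : ℕ | ∃ u ∈ e, ∃ w ∈ f, G.dist u w = d}

/-- `M` is an `r`-matching in `G`: a set of edges of `G` any two distinct members of which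
are at distance at least `r`. -/
def IsRMatching {V : Type*} (G : SimpleGraph V) (r : ℕ) (M : Finset (Sym2 V)) : Prop :=
  (∀ e ∈ M, e ∈ G.edgeSet) ∧ ∀ e ∈ M, ∀ f ∈ M, e ≠ f → r ≤ edgeDist G e f

/-- The number of `r`-matchings in `G`. -/
noncomputable def numRMatchings {V : Type*} (G : SimpleGraph V) (r : ℕ) : ℕ :=
  Nat.card {M : Finset (Sym2 V) // IsRMatching G r M}

/-- `s_r(P_n)`: the number of `r`-matchings in the path on `n` vertices. -/
noncomputable def pathMatchings (r n : ℕ) : ℕ :=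
  numRMatchings (SimpleGraph.pathGraph n) r

theorem le_edgeDist_iff {V : Type*} (G : SimpleGraph V) (a b c d : V) (r : ℕ) :
    r ≤ edgeDist G s(a, b) s(c, d) ↔
      r ≤ G.dist a c ∧ r ≤ G.dist a d ∧ r ≤ G.dist b c ∧ r ≤ G.dist b d := by
  unfold edgeDist
  constructor
  · intro h
    refine ⟨?_, ?_, ?_, ?_⟩
    all_goals
      refine h.trans (Nat.sInf_le ?_)
      refine ⟨_, ?_, _, ?_, rfl⟩ <;> simp
  · rintro ⟨h1, h2, h3, h4⟩
    apply le_csInf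
    · exact ⟨_, a, by simp, c, by simp, rfl⟩
    · rintro x ⟨u, hu, w, hw, rfl⟩
      rw [Sym2.mem_iff] at hu hw
      rcases hu with rfl | rfl <;> rcases hw with rfl | rfl <;> assumption

theorem dist_adj_ne {V : Type*} {G : SimpleGraph V} (hG : G.IsTree) {a b : V} (c : V)
    (h : G.Adj a b) : G.dist a c ≠ G.dist b c := by
  rw [SimpleGraph.dist_comm (u := a), SimpleGraph.dist_comm (u := b)]
  exact hG.dist_ne_of_adj c h

theorem tree_square {V : Type*} {G : SimpleGraph V} (hG : G.IsTree) {a b c d : V} {r : ℕ}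
    (hr : 1 ≤ r) (hab : G.Adj a b) (hcd : G.Adj c d)
    (hac : G.dist a c = r) (hbd : G.dist b d = r) (hbc : G.dist b c = r + 1)
    (had : G.dist a d = r + 1) : False := by
  obtain ⟨p, hp⟩ := hG.1.exists_walk_length_eq_dist a c
  obtain ⟨q, hq⟩ := hG.1.exists_walk_length_eq_dist b d
  have h1 : (SimpleGraph.Walk.cons hab q).IsPath :=
    SimpleGraph.Walk.isPath_of_length_eq_dist _ (by simp; omega)
  have h2 : (p.concat hcd).IsPath :=
    SimpleGraph.Walk.isPath_of_length_eq_dist _ (by simp; omega)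
  have h3 := congrArg Subtype.val (hG.2.path_unique ⟨_, h1⟩ ⟨_, h2⟩)
  have h4 : b ∈ (p.concat hcd).support := by
    rw [← show _ = p.concat hcd from h3]; simp
  rw [SimpleGraph.Walk.support_concat] at h4
  simp only [List.mem_append, List.mem_singleton] at h4
  rcases h4 with h4 | rfl
  · classical
    have := p.length_dropUntil_le_length h4
    have := SimpleGraph.dist_le (p.dropUntil b h4)
    omega
  · simp at hbd; omega

theorem far_of_edges {V : Type*} {G : SimpleGraph V} (hG : G.IsTree) {a b c d : V} {r : ℕ}
    (hr : 1 ≤ r) (hab : G.Adj a b) (hcd : G.Adj c d)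
    (h : r ≤ edgeDist G s(a, b) s(c, d)) : ∃ u v, r + 2 ≤ G.dist u v := by
  rw [le_edgeDist_iff] at h
  by_contra! hc
  have := hc a c
  have := hc a d
  have := hc b c
  have := hc b d
  have e1 := dist_adj_ne hG c hab
  have e2 := dist_adj_ne hG d hab
  have e3 := hG.dist_ne_of_adj a hcd
  by_cases hac : G.dist a c = r
  · exact tree_square hG hr hab hcd hac (by omega) (by omega) (by omega)
  · exact tree_square hG hr hab hcd.symm (c := d) (d := c) (r := r)
      (by omega) (by omega) (by omega) (by omega)

theorem edges_of_far {V : Type*} {G : SimpleGraph V} (hG : G.IsTree) {u v : V} {r : ℕ}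
    (h : r + 2 ≤ G.dist u v) : ∃ a b c d, G.Adj a b ∧ G.Adj c d ∧
      r ≤ edgeDist G s(a, b) s(c, d) := by
  have hne : u ≠ v := by rintro rfl; simp at h
  have key : ∀ u v, u ≠ v → ∃ b, G.Adj u b := by
    intro u v huv
    obtain ⟨p⟩ := hG.1.preconnected u v
    cases p with
    | nil => exact absurd rfl huv
    | cons h _ => exact ⟨_, h⟩
  obtain ⟨b, hb⟩ := key u v hne
  obtain ⟨c, hc⟩ := key v u hne.symm
  refine ⟨u, b, v, c, hb, hc, ?_⟩
  rw [le_edgeDist_iff]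
  have h1 := SimpleGraph.dist_eq_one_iff_adj.2 hb
  have h2 := SimpleGraph.dist_eq_one_iff_adj.2 hc.symm
  have t1 := hG.1.dist_triangle (u := u) (v := b) (w := v)
  have t2 := hG.1.dist_triangle (u := u) (v := c) (w := v)
  have t3 := hG.1.dist_triangle (u := b) (v := c) (w := v)
  omega

/-- For every integer `r ≥ 1`, a tree `T` on `n` vertices has exactly `n` `r`-matchings
if and only if the diameter of `T` is at most `r + 1`. -/
theorem stmt1 {V : Type*} [Fintype V] (r : ℕ) (hr : 1 ≤ r) (G : SimpleGraph V)
    (hG : G.IsTree) :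
    numRMatchings G r = Fintype.card V ↔ G.diam ≤ r + 1 := by
  classical
  let φ : Option G.edgeSet → {M : Finset (Sym2 V) // IsRMatching G r M} := fun o =>
    match o with
    | none => ⟨∅, by simp [IsRMatching]⟩
    | some e => ⟨{e.1}, by
        refine ⟨by simp, ?_⟩
        intro a ha b hb hab
        simp only [Finset.mem_singleton] at ha hb
        exact absurd (ha.trans hb.symm) hab⟩
  have hφ : Function.Injective φ := by
    rintro (_ | e) (_ | f) h
    · rfl
    · have := congrArg (fun M => M.1.card) h; simp [φ] at this
    · have := congrArg (fun M => M.1.card) h; simp [φ] at this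
    · simpa [φ, Subtype.ext_iff] using h
  have hcard : Fintype.card (Option G.edgeSet) = Fintype.card V := by
    have := hG.card_edgeFinset
    rw [Fintype.card_option, ← SimpleGraph.edgeFinset_card]
    convert this
  have hsurj : numRMatchings G r = Fintype.card V ↔ Function.Surjective φ := by
    unfold numRMatchings
    rw [← hcard, Nat.card_eq_fintype_card]
    constructor
    · intro h
      exact ((Fintype.bijective_iff_injective_and_card φ).2 ⟨hφ, h.symm⟩).2
    · intro h
      exact (Fintype.card_of_bijective ⟨hφ, h⟩).symm
  have hne : Nonempty V := hG.1.nonempty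
  have hfin : G.ediam ≠ ⊤ := SimpleGraph.connected_iff_ediam_ne_top.1 hG.1
  rw [hsurj]
  constructor
  · intro hs
    by_contra! hd
    obtain ⟨u, v, huv⟩ := G.exists_dist_eq_diam
    obtain ⟨a, b, c, d, hab, hcd, h⟩ := edges_of_far hG (u := u) (v := v) (r := r) (by omega)
    have h' := (le_edgeDist_iff ..).1 h
    have hef : s(a, b) ≠ s(c, d) := by
      intro he
      rw [← he, le_edgeDist_iff] at h
      simp at h
      omega
    have hM : IsRMatching G r {s(a, b), s(c, d)} := by
      refine ⟨by simp [hab, hcd], ?_⟩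
      intro e he f hf hne
      simp only [Finset.mem_insert, Finset.mem_singleton] at he hf
      rcases he with rfl | rfl <;> rcases hf with rfl | rfl
      · exact absurd rfl hne
      · exact h
      · rw [le_edgeDist_iff]
        simp only [SimpleGraph.dist_comm (u := c), SimpleGraph.dist_comm (u := d)]
        tauto
      · exact absurd rfl hne
    obtain ⟨o, ho⟩ := hs ⟨_, hM⟩
    have hc := congrArg (fun M => M.1.card) ho
    simp only [Finset.card_pair hef] at hc
    rcases o with _ | e <;> simp [φ] at hc
  · rintro hd ⟨M, hM⟩
    have hsub : ∀ e ∈ M, ∀ f ∈ M, e = f := by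
      intro e he f hf
      by_contra hne
      have h := hM.2 e he f hf hne
      have h1 := hM.1 e he
      have h2 := hM.1 f hf
      induction e with | _ a b
      induction f with | _ c d
      obtain ⟨u, v, huv⟩ := far_of_edges hG hr h1 h2 h
      have := SimpleGraph.dist_le_diam hfin (u := u) (v := v)
      omega
    rcases M.eq_empty_or_nonempty with rfl | ⟨e, he⟩
    · exact ⟨none, rfl⟩
    · refine ⟨some ⟨e, hM.1 e he⟩, ?_⟩
      apply Subtype.ext
      change {e} = M
      ext f
      simp only [Finset.mem_singleton]
      exact ⟨fun h => h ▸ he, fun h => hsub f h e he⟩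
end

section
/- Let r ≥ 1 be an integer and let s_r(P_n) denote the number of r-matchings in the path P_n on n vertices, with the convention s_r(P_0) = 1. Then for every n ≥ r+1, s_r(P_n) = s_r(P_{n-1}) + s_r(P_{n-r-1}). -/
open SimpleGraph Filter

lemma pathAux_lower {n : ℕ} {u w : Fin n} (p : (pathGraph n).Walk u w) :
    w.val ≤ u.val + p.length ∧ u.val ≤ w.val + p.length := by
  induction p with
  | nil => simp
  | cons h p ih =>
    rw [pathGraph_adj] at h
    simp only [Walk.length_cons]
    omega

lemma pathAux_walk {n : ℕ} (d : ℕ) : ∀ (u w : Fin n), u.val + d = w.val →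
    ∃ p : (pathGraph n).Walk u w, p.length = d := by
  induction d with
  | zero =>
    intro u w h
    obtain rfl : u = w := Fin.ext (by simpa using h)
    exact ⟨Walk.nil, rfl⟩
  | succ d ih =>
    intro u w h
    have hw := w.isLt
    obtain ⟨p, hp⟩ := ih ⟨u.val + 1, by omega⟩ w (by simp only; omega)
    exact ⟨Walk.cons (pathGraph_adj.2 (Or.inl rfl)) p, by simp [hp]⟩

lemma pathAux_dist {n : ℕ} (u w : Fin n) (h : u.val ≤ w.val) :
    (pathGraph n).dist u w = w.val - u.val := by
  obtain ⟨p, hp⟩ := pathAux_walk (w.val - u.val) u w (by omega)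
  have h1 := dist_le p
  obtain ⟨q, hq⟩ := (p.reachable).exists_walk_length_eq_dist
  have h2 := pathAux_lower q
  omega

def gAux (m i : ℕ) : Sym2 (Fin (m + 1)) := s(Fin.ofNat (m + 1) i, Fin.ofNat (m + 1) (i + 1))

lemma valAux {m i : ℕ} (h : i ≤ m) : (Fin.ofNat (m + 1) i).val = i := by
  simp [Fin.ofNat]; omega

lemma gAux_inj {m i j : ℕ} (hi : i < m) (hj : j < m) (h : gAux m i = gAux m j) : i = j := by
  have a1 := valAux (m := m) (i := i) (by omega)
  have a2 := valAux (m := m) (i := i + 1) (by omega)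
  have a3 := valAux (m := m) (i := j) (by omega)
  have a4 := valAux (m := m) (i := j + 1) (by omega)
  simp only [gAux, Sym2.eq_iff] at h
  rcases h with ⟨h1, h2⟩ | ⟨h1, h2⟩
  · rw [h1] at a1; omega
  · rw [h1] at a1; rw [h2] at a2; omega

lemma gAux_mem {m i : ℕ} (hi : i < m) : gAux m i ∈ (pathGraph (m + 1)).edgeSet := by
  rw [gAux, mem_edgeSet, pathGraph_adj, valAux (by omega), valAux (by omega)]
  simp

lemma gAux_surj {m : ℕ} (e : Sym2 (Fin (m + 1))) (he : e ∈ (pathGraph (m + 1)).edgeSet) :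
    ∃ i < m, gAux m i = e := by
  induction e with
  | _ u w =>
    rw [mem_edgeSet, pathGraph_adj] at he
    have hu := u.isLt
    have hw := w.isLt
    rcases he with h | h
    · refine ⟨u.val, by omega, ?_⟩
      rw [gAux, Sym2.eq_iff]
      left
      constructor <;> apply Fin.ext <;> rw [valAux (by omega)]
      exact h
    · refine ⟨w.val, by omega, ?_⟩
      rw [gAux, Sym2.eq_iff]
      right
      constructor <;> apply Fin.ext <;> rw [valAux (by omega)]
      exact h

lemma edgeDist_symmAux {V : Type*} (G : SimpleGraph V) (e f : Sym2 V) :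
    edgeDist G e f = edgeDist G f e := by
  unfold edgeDist
  congr 1
  ext d
  constructor <;> rintro ⟨u, hu, w, hw, h⟩ <;> exact ⟨w, hw, u, hu, by rw [dist_comm]; exact h⟩

lemma edgeDist_gAux {m i j : ℕ} (hij : i < j) (hj : j < m) :
    edgeDist (pathGraph (m + 1)) (gAux m i) (gAux m j) = j - (i + 1) := by
  have a1 := valAux (m := m) (i := i) (by omega)
  have a2 := valAux (m := m) (i := i + 1) (by omega)
  have a3 := valAux (m := m) (i := j) (by omega)
  have a4 := valAux (m := m) (i := j + 1) (by omega)
  unfold edgeDist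
  apply IsLeast.csInf_eq
  constructor
  · refine ⟨_, Sym2.mem_mk_right _ _, _, Sym2.mem_mk_left _ _, ?_⟩
    rw [pathAux_dist _ _ (by omega), a2, a3]
  · rintro d ⟨u, hu, w, hw, rfl⟩
    rw [gAux, Sym2.mem_iff] at hu hw
    have hu' : u.val = i ∨ u.val = i + 1 := by
      rcases hu with rfl | rfl
      · exact Or.inl a1
      · exact Or.inr a2
    have hw' : w.val = j ∨ w.val = j + 1 := by
      rcases hw with rfl | rfl
      · exact Or.inl a3
      · exact Or.inr a4
    rw [pathAux_dist _ _ (by omega)]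
    omega

def GoodAux (r : ℕ) (S : Finset ℕ) : Prop := ∀ i ∈ S, ∀ j ∈ S, i < j → i + r + 1 ≤ j

open Classical in
noncomputable def cntAux (r m : ℕ) : Finset (Finset ℕ) :=
  (Finset.range m).powerset.filter (GoodAux r)

lemma mem_cntAux {r m : ℕ} {S : Finset ℕ} :
    S ∈ cntAux r m ↔ (∀ i ∈ S, i < m) ∧ GoodAux r S := by
  simp [cntAux, Finset.subset_iff]

open Classical in
lemma path_succAux (r m : ℕ) (hr : 1 ≤ r) :
    pathMatchings r (m + 1) = (cntAux r m).card := by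
  unfold pathMatchings numRMatchings
  rw [← Nat.card_eq_finsetCard]
  symm
  refine Nat.card_eq_of_bijective
    (fun S : cntAux r m => (⟨S.1.image (gAux m), ?_⟩ :
      {M : Finset (Sym2 (Fin (m + 1))) // IsRMatching (pathGraph (m + 1)) r M})) ⟨?_, ?_⟩
  · obtain ⟨h1, h2⟩ := mem_cntAux.1 S.2
    constructor
    · intro e he
      obtain ⟨i, hi, rfl⟩ := Finset.mem_image.1 he
      exact gAux_mem (h1 i hi)
    · intro e he f hf hne
      obtain ⟨i, hi, rfl⟩ := Finset.mem_image.1 he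
      obtain ⟨j, hj, rfl⟩ := Finset.mem_image.1 hf
      rcases lt_trichotomy i j with h | h | h
      · rw [edgeDist_gAux h (h1 j hj)]
        have := h2 i hi j hj h
        omega
      · exact absurd (by rw [h]) hne
      · rw [edgeDist_symmAux, edgeDist_gAux h (h1 i hi)]
        have := h2 j hj i hi h
        omega
  · rintro ⟨S, hS⟩ ⟨T, hT⟩ h
    have hS := (mem_cntAux.1 hS).1
    have hT := (mem_cntAux.1 hT).1
    have h : S.image (gAux m) = T.image (gAux m) := congrArg Subtype.val h
    apply Subtype.ext
    ext i
    constructor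
    · intro hi
      have := Finset.mem_image_of_mem (gAux m) hi
      rw [h] at this
      obtain ⟨j, hj, e⟩ := Finset.mem_image.1 this
      rwa [← gAux_inj (hT j hj) (hS i hi) e]
    · intro hi
      have := Finset.mem_image_of_mem (gAux m) hi
      rw [← h] at this
      obtain ⟨j, hj, e⟩ := Finset.mem_image.1 this
      rwa [← gAux_inj (hS j hj) (hT i hi) e]
  · rintro ⟨M, hM1, hM2⟩
    refine ⟨⟨(Finset.range m).filter (fun i => gAux m i ∈ M), ?_⟩, ?_⟩
    · rw [mem_cntAux]
      constructor
      · intro i hi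
        simpa using (Finset.mem_filter.1 hi).1
      · intro i hi j hj hij
        rw [Finset.mem_filter, Finset.mem_range] at hi hj
        have := hM2 _ hi.2 _ hj.2 (fun e => by have := gAux_inj hi.1 hj.1 e; omega)
        rw [edgeDist_gAux hij hj.1] at this
        omega
    · apply Subtype.ext
      ext e
      simp only [Finset.mem_image, Finset.mem_filter, Finset.mem_range]
      constructor
      · rintro ⟨i, hi, rfl⟩
        exact hi.2
      · intro he
        obtain ⟨i, hi, rfl⟩ := gAux_surj e (hM1 e he)
        exact ⟨i, ⟨hi, he⟩, rfl⟩

lemma path_zeroAux (r : ℕ) : pathMatchings r 0 = 1 := by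
  unfold pathMatchings numRMatchings
  rw [Nat.card_eq_one_iff_unique]
  refine ⟨⟨?_⟩, ⟨⟨∅, by simp [IsRMatching]⟩⟩⟩
  rintro ⟨a, ha⟩ ⟨b, hb⟩
  apply Subtype.ext
  ext e
  induction e with
  | _ u w => exact u.elim0

lemma cnt_zeroAux (r : ℕ) : (cntAux r 0).card = 1 := by
  rw [Finset.card_eq_one]
  refine ⟨∅, ?_⟩
  ext S
  rw [mem_cntAux, Finset.mem_singleton, Finset.eq_empty_iff_forall_notMem]
  constructor
  · intro h i hi
    exact absurd (h.1 i hi) (by omega)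
  · intro h
    exact ⟨fun i hi => absurd hi (h i), fun i hi => absurd hi (h i)⟩

lemma pathAux (r m : ℕ) (hr : 1 ≤ r) : pathMatchings r m = (cntAux r (m - 1)).card := by
  cases m with
  | zero => rw [path_zeroAux, cnt_zeroAux]
  | succ m => exact path_succAux r m hr

lemma cnt_succAux (r k : ℕ) :
    (cntAux r (k + 1)).card = (cntAux r k).card + (cntAux r (k - r)).card := by
  classical
  have hnot : ∀ S ∈ cntAux r (k - r), k ∉ S := by
    intro S hS hk
    have := (mem_cntAux.1 hS).1 k hk
    omega
  have hU : cntAux r (k + 1) = cntAux r k ∪ (cntAux r (k - r)).image (insert k) := by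
    ext S
    rw [Finset.mem_union, Finset.mem_image]
    constructor
    · intro hS
      obtain ⟨h1, h2⟩ := mem_cntAux.1 hS
      by_cases hk : k ∈ S
      · right
        refine ⟨S.erase k, ?_, Finset.insert_erase hk⟩
        rw [mem_cntAux]
        constructor
        · intro i hi
          rw [Finset.mem_erase] at hi
          have := h1 i hi.2
          have := h2 i hi.2 k hk (by omega)
          omega
        · intro i hi j hj
          exact h2 i (Finset.mem_of_mem_erase hi) j (Finset.mem_of_mem_erase hj)
      · left
        rw [mem_cntAux]
        refine ⟨fun i hi => ?_, h2⟩
        have := h1 i hi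
        have : i ≠ k := fun h => hk (h ▸ hi)
        omega
    · rintro (h | ⟨T, hT, rfl⟩)
      · rw [mem_cntAux] at h ⊢
        exact ⟨fun i hi => by have := h.1 i hi; omega, h.2⟩
      · rw [mem_cntAux] at hT ⊢
        constructor
        · intro i hi
          rcases Finset.mem_insert.1 hi with rfl | hi
          · omega
          · have := hT.1 i hi
            omega
        · intro i hi j hj hij
          rcases Finset.mem_insert.1 hi with hi' | hi' <;>
            rcases Finset.mem_insert.1 hj with hj' | hj'
          · omega
          · have := hT.1 j hj'
            omega
          · have := hT.1 i hi'
            omega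
          · exact hT.2 i hi' j hj' hij
  rw [hU, Finset.card_union_of_disjoint, Finset.card_image_of_injOn]
  · intro S hS T hT h
    have h : insert k S = insert k T := h
    rw [← Finset.erase_insert (hnot S hS), h, Finset.erase_insert (hnot T hT)]
  · rw [Finset.disjoint_left]
    intro S hS hS'
    obtain ⟨T, _, rfl⟩ := Finset.mem_image.1 hS'
    have := (mem_cntAux.1 hS).1 k (Finset.mem_insert_self _ _)
    omega

/-- For every `r ≥ 1` and every `n ≥ r + 1`,
`s_r(P_n) = s_r(P_{n-1}) + s_r(P_{n-r-1})`. -/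
theorem stmt2 (r : ℕ) (hr : 1 ≤ r) (n : ℕ) (hn : r + 1 ≤ n) :
    pathMatchings r n = pathMatchings r (n - 1) + pathMatchings r (n - r - 1) := by
  obtain ⟨k, rfl⟩ : ∃ k, n = k + 2 := ⟨n - 2, by omega⟩
  rw [pathAux r _ hr, pathAux r _ hr, pathAux r _ hr]
  have e1 : k + 2 - 1 = k + 1 := by omega
  have e2 : k + 2 - r - 1 - 1 = k - r := by omega
  rw [e2, e1, Nat.add_sub_cancel, cnt_succAux]
end

section
/- For every integer r ≥ 1, every complex root q of the polynomial p_r(x) = x^{r+1} - x^r - 1 other than the unique positive real root β_r satisfies |q| < β_r. In particular, β_r is the unique root of p_r of maximum modulus. -/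
open SimpleGraph Filter

/-- Every complex root of `x^{r+1} - x^r - 1` other than the unique positive real root `β`
has modulus strictly less than `β`. -/
theorem stmt4 (r : ℕ) (hr : 1 ≤ r) (β : ℝ) (hβ : 0 < β)
    (hroot : β ^ (r + 1) - β ^ r - 1 = 0) :
    ∀ q : ℂ, q ^ (r + 1) - q ^ r - 1 = 0 → q ≠ (β : ℂ) → ‖q‖ < β := by
  intro q hq hne
  by_contra! hle
  apply hne
  have h1 : β ^ r * (β - 1) = 1 := by rw [pow_succ] at hroot; linarith
  have h2 : q ^ r * (q - 1) = 1 := by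
    rw [pow_succ] at hq; linear_combination hq
  have h3 : ‖q‖ ^ r * ‖q - 1‖ = 1 := by
    rw [← norm_pow, ← norm_mul, h2, norm_one]
  have hp : 0 < β ^ r := pow_pos hβ r
  have h4 : β ^ r ≤ ‖q‖ ^ r := pow_le_pow_left₀ hβ.le hle r
  have h5 : ‖q - 1‖ ≤ β - 1 := by
    have := mul_le_mul_of_nonneg_right h4 (norm_nonneg (q - 1))
    exact le_of_mul_le_mul_left (by linarith) hp
  have h6 : ‖q‖ - 1 ≤ ‖q - 1‖ := by
    have := norm_sub_norm_le q 1
    rwa [norm_one] at this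
  have h7 : ‖q‖ = β := by linarith
  have h8 : q.re * q.re + q.im * q.im = β ^ 2 := by
    rw [← h7, Complex.sq_norm, Complex.normSq_apply]
  have h9 : (q.re - 1) * (q.re - 1) + q.im * q.im ≤ (β - 1) ^ 2 := by
    have := pow_le_pow_left₀ (norm_nonneg _) h5 2
    rw [Complex.sq_norm, Complex.normSq_apply] at this
    simpa using this
  have h10 : β ≤ q.re := by nlinarith
  have h11 : q.re ≤ β := h7 ▸ Complex.re_le_norm q
  have h12 : q.re = β := le_antisymm h11 h10
  have h13 : q.im = 0 := by
    rw [h12] at h8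
    exact mul_self_eq_zero.mp (by linarith [sq β])
  apply Complex.ext <;> simp [h12, h13]
end

section
/- For all sufficiently large integers r, the unique positive real root β_r of x^{r+1} - x^r - 1 satisfies (r/log r)^{1/r} < β_r < ((1 + 1/√(log r)) · r/log r)^{1/r}; equivalently, r/log r < β_r^r < (1 + 1/√(log r)) · r/log r. Here log denotes the natural logarithm. -/
open SimpleGraph Filter

theorem stmt5_aux (r : ℕ) (L : ℝ) (hL : L = Real.log r) (hr : (0:ℝ) < r) (h1 : L ^ 2 ≤ r)
    (h2 : 1 ≤ Real.log L) (h3 : Real.log L ≤ 1 / 2 * Real.sqrt L) (hL1 : 1 < L)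
    (β : ℝ) (hβ : 0 < β) (h : β ^ (r + 1) - β ^ r - 1 = 0) :
      (r : ℝ) / L < β ^ r ∧
      β ^ r < (1 + 1 / Real.sqrt L) * ((r : ℝ) / L) := by
  have hy : 0 < β ^ r := by positivity
  have hlog : Real.log (β ^ r) = r * Real.log β := by rw [Real.log_pow]
  have hb : β = 1 + 1 / β ^ r := by
    field_simp
    rw [pow_succ] at h
    linarith
  generalize hyy : β ^ r = y at *
  have hL0 : 0 < L := by linarith
  have hlow : 1 / (y + 1) ≤ Real.log β := by
    have := Real.one_sub_inv_le_log_of_pos hβ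
    have e : 1 - β⁻¹ = 1 / (y + 1) := by
      rw [hb]; field_simp; ring
    linarith
  have hup : Real.log β ≤ 1 / y := by
    have := Real.log_le_sub_one_of_pos hβ
    linarith
  constructor
  · by_contra hc
    push Not at hc
    have a1 : Real.log y ≤ L - Real.log L := by
      have e : L - Real.log L = Real.log (r / L) := by
        rw [Real.log_div hr.ne' hL0.ne', ← hL]
      rw [e]
      exact Real.log_le_log hy hc
    have a2 : r * (1 / (y + 1)) ≤ Real.log y := by rw [hlog]; gcongr
    have a3 : r * (1 / (y + 1)) ≤ L - 1 := by linarith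
    rw [mul_one_div, div_le_iff₀ (by linarith)] at a3
    have a4 : y * L ≤ r := by rwa [le_div_iff₀ hL0] at hc
    nlinarith
  · by_contra hc
    push Not at hc
    set s := Real.sqrt L with hs
    have hs1 : 1 < s := by rw [hs]; exact Real.lt_sqrt_of_sq_lt (by simpa using hL1)
    have hsL : s * s = L := Real.mul_self_sqrt hL0.le
    have hc1 : 0 < 1 / s := by positivity
    have hrl : 0 < r / L := by positivity
    have a1 : L - Real.log L < Real.log y := by
      have e : L - Real.log L = Real.log (r / L) := by
        rw [Real.log_div hr.ne' hL0.ne', ← hL]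
      rw [e]
      apply Real.log_lt_log hrl
      nlinarith
    have a2 : Real.log y ≤ r * (1 / y) := by rw [hlog]; gcongr
    have a3 : L - Real.log L < r / y := by rw [mul_one_div] at a2; linarith
    rw [lt_div_iff₀ hy] at a3
    have a5 : (1 + 1 / s) * (r / L) = (s + 1) * r / (s * L) := by field_simp
    rw [a5, div_le_iff₀ (by positivity)] at hc
    have a6 : L - s / 2 ≤ L - Real.log L := by linarith
    have a7 : (L - s / 2) * y < r := by nlinarith
    have a8 : (s + 1) * ((L - s / 2) * y) < (s + 1) * r := by gcongr
    have a9 : (s + 1) * (L - s / 2) < s * L := by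
      by_contra hh
      push Not at hh
      nlinarith
    rw [← hsL] at a9
    nlinarith

/-- For all sufficiently large `r`, the root satisfies the bounds. -/
theorem stmt5 :
    ∃ R : ℕ, ∀ r : ℕ, R ≤ r → ∀ β : ℝ, 0 < β → β ^ (r + 1) - β ^ r - 1 = 0 →
      (r : ℝ) / Real.log r < β ^ r ∧
      β ^ r < (1 + 1 / Real.sqrt (Real.log r)) * ((r : ℝ) / Real.log r) := by
  have t0 : Tendsto (fun n : ℕ => (n : ℝ)) atTop atTop := tendsto_natCast_atTop_atTop
  have t1 := Real.tendsto_log_atTop.comp t0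
  have t2 := Real.tendsto_log_atTop.comp t1
  have e1 := t0.eventually ((Real.isLittleO_pow_log_id_atTop (n := 2)).bound one_pos)
  have e2 := t1.eventually ((isLittleO_log_rpow_atTop (r := 1/2) (by norm_num)).bound
    (show (0:ℝ) < 1/2 by norm_num))
  have key := (t0.eventually_gt_atTop 0).and ((t1.eventually_gt_atTop 1).and
    ((t2.eventually_ge_atTop 1).and (e1.and e2)))
  obtain ⟨R, hR⟩ := eventually_atTop.1 key
  refine ⟨R, fun r hr β hβ h => ?_⟩
  obtain ⟨k0, k1, k2, k3, k4⟩ := hR r hr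
  simp only [Function.comp] at k1 k2 k4
  refine stmt5_aux r _ rfl k0 ?_ k2 ?_ k1 β hβ h
  · have := (le_abs_self _).trans k3
    simpa using this
  · have := (le_abs_self _).trans k4
    rw [← Real.sqrt_eq_rpow, Real.norm_of_nonneg (Real.sqrt_nonneg _)] at this
    exact this
end

section
/- As r → ∞, β_r^r = (1+o(1)) · r/log r, where β_r is the unique positive real root of x^{r+1} - x^r - 1; that is, the quantity β_r^r · (log r)/r tends to 1 as the integer r tends to infinity. -/
open SimpleGraph Filter

/-- As `r → ∞`, `β_r^r = (1 + o(1)) · r / log r`, i.e. `β_r^r · (log r) / r → 1`,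
where `β_r` is the unique positive real root of `x^{r+1} - x^r - 1`. -/
theorem stmt6 (β : ℕ → ℝ)
    (hβ : ∀ r : ℕ, 1 ≤ r → 0 < β r ∧ (β r) ^ (r + 1) - (β r) ^ r - 1 = 0) :
    Filter.Tendsto (fun r : ℕ => (β r) ^ r * Real.log r / r) Filter.atTop (nhds 1) := by
  have hy : ∀ r : ℕ, 1 ≤ r → 1 < β r ∧ 1 < β r ^ r ∧ β r ^ r * (β r - 1) = 1 := by
    intro r hr
    obtain ⟨h0, h1⟩ := hβ r hr
    have h2 : β r ^ r * (β r - 1) = 1 := by rw [pow_succ] at h1; linarith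
    have h3 : 0 < β r ^ r := pow_pos h0 r
    have h4 : 1 < β r := by
      by_contra h
      push Not at h
      nlinarith
    exact ⟨h4, one_lt_pow₀ h4 (by omega), h2⟩
  have hA : ∀ r : ℕ, 1 ≤ r → (β r)⁻¹ ≤ β r ^ r * Real.log (β r) ∧
      β r ^ r * Real.log (β r) ≤ 1 := by
    intro r hr
    obtain ⟨h1, h2, h3⟩ := hy r hr
    have h0 : 0 < β r := by linarith
    have h4 := Real.one_sub_inv_le_log_of_pos h0
    have h5 := Real.log_le_sub_one_of_pos h0
    constructor
    · have h6 : (β r)⁻¹ = β r ^ r * (1 - (β r)⁻¹) := by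
        have : β r ^ r * (1 - (β r)⁻¹) = β r ^ r * (β r - 1) * (β r)⁻¹ := by
          field_simp
        rw [this, h3, one_mul]
      rw [h6]
      exact mul_le_mul_of_nonneg_left h4 (by linarith)
    · rw [← h3]
      exact mul_le_mul_of_nonneg_left h5 (by linarith)
  have hytop : Tendsto (fun r : ℕ => β r ^ r) atTop atTop := by
    rw [tendsto_atTop]
    intro b
    have hr := tendsto_natCast_atTop_atTop (R := ℝ)
    filter_upwards [hr.eventually_ge_atTop (2 * b ^ 2), eventually_ge_atTop 1] with r h1 h2
    obtain ⟨g1, g2, g3⟩ := hy r h2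
    have g4 := (hA r h2).1
    have g5 : β r ≤ 2 := by nlinarith
    have g6 : (2 : ℝ)⁻¹ ≤ (β r)⁻¹ := inv_anti₀ (by linarith) g5
    have g7 : Real.log (β r ^ r) = r * Real.log (β r) := Real.log_pow _ _
    have g8 : Real.log (β r ^ r) ≤ β r ^ r - 1 := Real.log_le_sub_one_of_pos (by linarith)
    have g9 : (r : ℝ) * 2⁻¹ ≤ r * (β r ^ r * Real.log (β r)) :=
      mul_le_mul_of_nonneg_left (g6.trans g4) (by positivity)
    have g10 : (r : ℝ) * (β r ^ r * Real.log (β r)) = β r ^ r * Real.log (β r ^ r) := by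
      rw [g7]; ring
    have g11 : β r ^ r * Real.log (β r ^ r) ≤ β r ^ r * (β r ^ r - 1) :=
      mul_le_mul_of_nonneg_left g8 (by linarith)
    by_contra h
    push Not at h
    nlinarith
  have hb : Tendsto (fun r : ℕ => (β r)⁻¹) atTop (nhds 1) := by
    have h1 : Tendsto (fun r : ℕ => (1 + (β r ^ r)⁻¹)⁻¹) atTop (nhds 1) := by
      have := (hytop.inv_tendsto_atTop.const_add (1 : ℝ)).inv₀ (by norm_num)
      simpa using this
    refine h1.congr' ?_
    filter_upwards [eventually_ge_atTop 1] with r hr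
    obtain ⟨g1, g2, g3⟩ := hy r hr
    rw [inv_eq_of_mul_eq_one_right g3]
    congr 1
    ring
  have hAlim : Tendsto (fun r : ℕ => β r ^ r * Real.log (β r)) atTop (nhds 1) := by
    refine tendsto_of_tendsto_of_tendsto_of_le_of_le' hb tendsto_const_nhds ?_ ?_
    · filter_upwards [eventually_ge_atTop 1] with r hr using (hA r hr).1
    · filter_upwards [eventually_ge_atTop 1] with r hr using (hA r hr).2
  have hlogy : Tendsto (fun r : ℕ => Real.log (β r ^ r)) atTop atTop :=
    Real.tendsto_log_atTop.comp hytop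
  have hll : Tendsto (fun r : ℕ => Real.log (Real.log (β r ^ r)) / Real.log (β r ^ r))
      atTop (nhds 0) :=
    (Real.isLittleO_log_id_atTop.tendsto_div_nhds_zero).comp hlogy
  have hlA : Tendsto (fun r : ℕ => Real.log (β r ^ r * Real.log (β r)) / Real.log (β r ^ r))
      atTop (nhds 0) := by
    have h1 : Tendsto (fun r : ℕ => Real.log (β r ^ r * Real.log (β r))) atTop (nhds 0) := by
      simpa using hAlim.log one_ne_zero
    exact h1.div_atTop hlogy
  have hfin := hAlim.mul ((hll.const_add 1).sub hlA)
  simp only [add_zero, sub_zero, mul_one] at hfin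
  refine hfin.congr' ?_
  filter_upwards [eventually_ge_atTop 1] with r hr
  obtain ⟨g1, g2, g3⟩ := hy r hr
  have hr0 : (0 : ℝ) < r := by exact_mod_cast hr
  have k1 : 0 < Real.log (β r) := Real.log_pos g1
  have k2 : 0 < Real.log (β r ^ r) := Real.log_pos g2
  have k3 : Real.log (β r ^ r) = r * Real.log (β r) := Real.log_pow _ _
  have k4 : Real.log (β r ^ r * Real.log (β r)) =
      Real.log (β r ^ r) + Real.log (Real.log (β r)) :=
    Real.log_mul (by positivity) k1.ne'
  have k5 : Real.log (Real.log (β r ^ r)) = Real.log r + Real.log (Real.log (β r)) := by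
    rw [k3, Real.log_mul hr0.ne' k1.ne']
  have k6 : 1 + Real.log (Real.log (β r ^ r)) / Real.log (β r ^ r) -
      Real.log (β r ^ r * Real.log (β r)) / Real.log (β r ^ r) =
      Real.log r / Real.log (β r ^ r) := by
    rw [k4, k5]
    field_simp
    ring
  rw [k6, k3]
  field_simp
end

section
/- For every integer r ≥ 1 there exists a constant c > 0 such that for all n ≥ 1, the number of r-matchings in the path P_n satisfies s_r(P_n) ≥ c · β_r^{n-1}, where β_r is the unique positive real root of x^{r+1} - x^r - 1. -/
open SimpleGraph Filter

open Classical in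
noncomputable def sparseSets (r m : ℕ) : Finset (Finset ℕ) :=
  (Finset.range m).powerset.filter (fun S => ∀ i ∈ S, ∀ j ∈ S, i < j → i + r + 1 ≤ j)

theorem mem_sparseSets {r m : ℕ} {S : Finset ℕ} :
    S ∈ sparseSets r m ↔
      (∀ i ∈ S, i < m) ∧ ∀ i ∈ S, ∀ j ∈ S, i < j → i + r + 1 ≤ j := by
  simp only [sparseSets, Finset.mem_filter, Finset.mem_powerset]
  constructor
  · rintro ⟨h, h2⟩
    exact ⟨fun i hi => Finset.mem_range.1 (h hi), h2⟩
  · rintro ⟨h, h2⟩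
    exact ⟨fun i hi => Finset.mem_range.2 (h i hi), h2⟩

theorem sparseSets_pos (r m : ℕ) : 1 ≤ (sparseSets r m).card := by
  apply Finset.card_pos.2
  exact ⟨∅, mem_sparseSets.2 (by simp)⟩

theorem sparseSets_succ (r m : ℕ) :
    (sparseSets r m).card + (sparseSets r (m - r)).card ≤ (sparseSets r (m + 1)).card := by
  classical
  have hinj : Set.InjOn (insert m : Finset ℕ → Finset ℕ) (sparseSets r (m - r)) := by
    intro S hS T hT h
    have hS' := (mem_sparseSets.1 (Finset.mem_coe.1 hS)).1
    have hT' := (mem_sparseSets.1 (Finset.mem_coe.1 hT)).1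
    have h1 : m ∉ S := fun h => by have := hS' m h; omega
    have h2 : m ∉ T := fun h => by have := hT' m h; omega
    have h3 : (insert m S).erase m = (insert m T).erase m := congrArg (fun X => X.erase m) h
    rwa [Finset.erase_insert h1, Finset.erase_insert h2] at h3
  rw [← Finset.card_image_of_injOn hinj, ← Finset.card_union_of_disjoint]
  · apply Finset.card_le_card
    intro S hS
    rw [Finset.mem_union, Finset.mem_image] at hS
    rcases hS with hS | ⟨T, hT, rfl⟩
    · rw [mem_sparseSets] at hS ⊢
      exact ⟨fun i hi => by have := hS.1 i hi; omega, hS.2⟩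
    · rw [mem_sparseSets] at hT ⊢
      obtain ⟨a, b⟩ := hT
      constructor
      · intro i hi
        rcases Finset.mem_insert.1 hi with rfl | hi
        · omega
        · have := a i hi; omega
      · intro i hi j hj hij
        rcases Finset.mem_insert.1 hi with hi | hi <;> rcases Finset.mem_insert.1 hj with hj | hj
        · omega
        · have := a j hj; omega
        · have := a i hi; omega
        · exact b i hi j hj hij
  · rw [Finset.disjoint_left]
    intro S hS hS2
    obtain ⟨T, hT, rfl⟩ := Finset.mem_image.1 hS2
    have := (mem_sparseSets.1 hS).1 m (Finset.mem_insert_self _ _)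
    omega

theorem path_walk_len {n : ℕ} {u w : Fin n} (p : (SimpleGraph.pathGraph n).Walk u w) :
    (w : ℕ) ≤ u + p.length ∧ (u : ℕ) ≤ w + p.length := by
  induction p with
  | nil => simp
  | cons h p ih =>
    rw [SimpleGraph.pathGraph_adj] at h
    rw [SimpleGraph.Walk.length_cons]
    omega

theorem path_dist {k : ℕ} (u w : Fin (k + 1)) :
    (w : ℕ) ≤ u + (SimpleGraph.pathGraph (k + 1)).dist u w ∧
      (u : ℕ) ≤ w + (SimpleGraph.pathGraph (k + 1)).dist u w := by
  obtain ⟨p, hp⟩ := (SimpleGraph.pathGraph_connected k).exists_walk_length_eq_dist u w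
  rw [← hp]
  exact path_walk_len p

def pathEdge (k i : ℕ) : Sym2 (Fin (k + 1)) := s(Fin.ofNat (k + 1) i, Fin.ofNat (k + 1) (i + 1))

theorem mem_pathEdge {k i : ℕ} (hi : i < k) (u : Fin (k + 1)) :
    u ∈ pathEdge k i ↔ (u : ℕ) = i ∨ (u : ℕ) = i + 1 := by
  have h1 : i % (k + 1) = i := Nat.mod_eq_of_lt (by omega)
  have h2 : (i + 1) % (k + 1) = i + 1 := Nat.mod_eq_of_lt (by omega)
  simp [pathEdge, Fin.ext_iff, Fin.ofNat, h1, h2]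

theorem pathEdge_mem {k i : ℕ} (hi : i < k) :
    pathEdge k i ∈ (SimpleGraph.pathGraph (k + 1)).edgeSet := by
  have h1 : i % (k + 1) = i := Nat.mod_eq_of_lt (by omega)
  have h2 : (i + 1) % (k + 1) = i + 1 := Nat.mod_eq_of_lt (by omega)
  simp only [pathEdge, SimpleGraph.mem_edgeSet, SimpleGraph.pathGraph_adj, Fin.ofNat]
  left
  rw [h1, h2]

theorem pathEdge_inj {k i j : ℕ} (hi : i < k) (hj : j < k) (h : pathEdge k i = pathEdge k j) :
    i = j := by
  have a := (mem_pathEdge hi ⟨i, by omega⟩).2 (Or.inl rfl)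
  have b := (mem_pathEdge hi ⟨i + 1, by omega⟩).2 (Or.inr rfl)
  rw [h, mem_pathEdge hj] at a b
  simp only at a b
  omega

theorem le_edgeDist {k i j r : ℕ} (hi : i < k) (hj : j < k)
    (h : i + r + 1 ≤ j ∨ j + r + 1 ≤ i) :
    r ≤ edgeDist (SimpleGraph.pathGraph (k + 1)) (pathEdge k i) (pathEdge k j) := by
  unfold edgeDist
  apply le_csInf
  · exact ⟨_, ⟨i, by omega⟩, (mem_pathEdge hi _).2 (Or.inl rfl), ⟨j, by omega⟩,
      (mem_pathEdge hj _).2 (Or.inl rfl), rfl⟩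
  · rintro d ⟨u, hu, w, hw, rfl⟩
    rw [mem_pathEdge hi] at hu
    rw [mem_pathEdge hj] at hw
    have := path_dist u w
    omega

theorem sparse_le_path (r k : ℕ) : (sparseSets r k).card ≤ pathMatchings r (k + 1) := by
  classical
  unfold pathMatchings numRMatchings
  have hv : ∀ S : {S // S ∈ sparseSets r k},
      IsRMatching (SimpleGraph.pathGraph (k + 1)) r (S.1.image (pathEdge k)) := by
    rintro ⟨S, hS⟩
    obtain ⟨a, b⟩ := mem_sparseSets.1 hS
    constructor
    · intro e he
      obtain ⟨i, hi, rfl⟩ := Finset.mem_image.1 he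
      exact pathEdge_mem (a i hi)
    · intro e he f hf hef
      obtain ⟨i, hi, rfl⟩ := Finset.mem_image.1 he
      obtain ⟨j, hj, rfl⟩ := Finset.mem_image.1 hf
      apply le_edgeDist (a i hi) (a j hj)
      rcases lt_trichotomy i j with h | h | h
      · exact Or.inl (b i hi j hj h)
      · exact absurd (congrArg _ h) hef
      · exact Or.inr (b j hj i hi h)
  have hsub : ∀ S T : Finset ℕ, (∀ i ∈ S, i < k) → (∀ i ∈ T, i < k) →
      S.image (pathEdge k) = T.image (pathEdge k) → S ⊆ T := by
    intro S T hS hT h i hi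
    have h2 : pathEdge k i ∈ T.image (pathEdge k) := h ▸ Finset.mem_image_of_mem _ hi
    obtain ⟨j, hj, hji⟩ := Finset.mem_image.1 h2
    rwa [← pathEdge_inj (hT j hj) (hS i hi) hji]
  have := Nat.card_le_card_of_injective
    (fun S : {S // S ∈ sparseSets r k} =>
      (⟨S.1.image (pathEdge k), hv S⟩ :
        {M // IsRMatching (SimpleGraph.pathGraph (k + 1)) r M})) (by
      rintro ⟨S, hS⟩ ⟨T, hT⟩ h
      have h' := congrArg Subtype.val h
      have hS' := (mem_sparseSets.1 hS).1
      have hT' := (mem_sparseSets.1 hT).1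
      exact Subtype.ext (Finset.Subset.antisymm (hsub S T hS' hT' h') (hsub T S hT' hS' h'.symm)))
  simpa using this

/-- For every `r ≥ 1` there is a constant `c > 0` with `s_r(P_n) ≥ c · β_r^{n-1}` for all
`n ≥ 1`, where `β_r` is the unique positive real root of `x^{r+1} - x^r - 1`. -/
theorem stmt7 (r : ℕ) (hr : 1 ≤ r) (β : ℝ) (hβ : 0 < β)
    (hroot : β ^ (r + 1) - β ^ r - 1 = 0) :
    ∃ c : ℝ, 0 < c ∧ ∀ n : ℕ, 1 ≤ n → c * β ^ (n - 1) ≤ (pathMatchings r n : ℝ) := by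
  have h1 : 1 ≤ β := by
    by_contra h
    have : β ^ (r + 1) ≤ β ^ r := pow_le_pow_of_le_one hβ.le (by linarith) (by omega)
    linarith
  have key : ∀ m : ℕ, β ^ m ≤ β ^ r * ((sparseSets r m).card : ℝ) := by
    intro m
    induction m using Nat.strong_induction_on with
    | _ m ih =>
      rcases Nat.lt_or_ge r m with hm | hm
      · obtain ⟨t, rfl⟩ : ∃ t, m = t + r + 1 := ⟨m - r - 1, by omega⟩
        have a := ih (t + r) (by omega)
        have b := ih t (by omega)
        have c := sparseSets_succ r (t + r)
        rw [Nat.add_sub_cancel] at c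
        have c' : ((sparseSets r (t + r)).card : ℝ) + (sparseSets r t).card
          ≤ (sparseSets r (t + r + 1)).card := by exact_mod_cast c
        have d := mul_le_mul_of_nonneg_left c' (pow_pos hβ r).le
        have e : β ^ (t + r + 1) = β ^ (t + r) + β ^ t := by
          have : β ^ (r + 1) = β ^ r + 1 := by linarith
          rw [add_assoc, pow_add, this, pow_add]; ring
        rw [e]
        linarith
      · have a : β ^ m ≤ β ^ r := pow_le_pow_right₀ h1 hm
        have b : (1 : ℝ) ≤ (sparseSets r m).card := by exact_mod_cast sparseSets_pos r m
        nlinarith [pow_pos hβ r]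
  refine ⟨(β ^ r)⁻¹, inv_pos.2 (pow_pos hβ r), ?_⟩
  intro n hn
  obtain ⟨k, rfl⟩ : ∃ k, n = k + 1 := ⟨n - 1, by omega⟩
  have a : ((sparseSets r k).card : ℝ) ≤ pathMatchings r (k + 1) := by
    exact_mod_cast sparse_le_path r k
  rw [Nat.add_sub_cancel]
  refine le_trans ?_ a
  rw [inv_mul_le_iff₀ (pow_pos hβ r)]
  exact key k
end

section
/- As r → ∞, the constant C_r = β_r^{2r}/(β_r^r + r + 1) satisfies C_r = (1+o(1)) · r/(log r)^2; that is, C_r · (log r)^2 / r tends to 1 as the integer r tends to infinity. Here β_r is the unique positive real root of x^{r+1} - x^r - 1 and log denotes the natural logarithm. -/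
open SimpleGraph Filter

/-- As `r → ∞`, `C_r = β_r^{2r} / (β_r^r + r + 1)` satisfies `C_r = (1+o(1)) · r/(log r)^2`,
i.e. `C_r · (log r)^2 / r → 1`. -/
theorem stmt10 (β : ℕ → ℝ)
    (hβ : ∀ r : ℕ, 1 ≤ r → 0 < β r ∧ (β r) ^ (r + 1) - (β r) ^ r - 1 = 0) :
    Filter.Tendsto
      (fun r : ℕ => ((β r) ^ (2 * r) / ((β r) ^ r + r + 1)) * (Real.log r) ^ 2 / r)
      Filter.atTop (nhds 1) := by
  have key : ∀ r : ℕ, 1 ≤ r → 0 < (β r)^r ∧ 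
      Real.log ((β r)^r) = r * Real.log (1 + 1 / (β r)^r) := by
    intro r hr
    obtain ⟨h0, h1⟩ := hβ r hr
    have hy : 0 < (β r)^r := pow_pos h0 r
    refine ⟨hy, ?_⟩
    have : 1 + 1 / (β r)^r = β r := by
      field_simp
      rw [pow_succ] at h1
      linarith
    rw [this, Real.log_pow]
  obtain ⟨y, hyd⟩ : ∃ y : ℕ → ℝ, ∀ r, y r = (β r)^r := ⟨_, fun _ => rfl⟩
  simp only [← hyd] at key
  have hcast : Tendsto (fun r : ℕ => (r : ℝ)) atTop atTop := tendsto_natCast_atTop_atTop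
  have hy : Tendsto y atTop atTop := by
    have h1 : Tendsto (fun r : ℕ => Real.sqrt r + (-1)) atTop atTop :=
      tendsto_atTop_add_const_right _ _ (Real.tendsto_sqrt_atTop.comp hcast)
    refine tendsto_atTop_mono' _ ?_ h1
    filter_upwards [eventually_ge_atTop 1] with r hr
    obtain ⟨h0, h2⟩ := key r hr
    have h3 : 1 - (1 + 1 / y r)⁻¹ ≤ Real.log (1 + 1 / y r) :=
      Real.one_sub_inv_le_log_of_pos (by positivity)
    have h4 : 1 - (1 + 1 / y r)⁻¹ = 1 / (y r + 1) := by
      field_simp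
      ring
    rw [h4] at h3
    have h5 : Real.log (y r) ≤ y r - 1 := Real.log_le_sub_one_of_pos h0
    have h6 : (r : ℝ) * (1 / (y r + 1)) ≤ y r - 1 := by
      rw [h2] at h5
      exact (mul_le_mul_of_nonneg_left h3 (Nat.cast_nonneg r)).trans h5
    have h7 : (r : ℝ) ≤ (y r + 1)^2 := by
      rw [mul_one_div, div_le_iff₀ (by positivity)] at h6
      nlinarith
    have := Real.sqrt_le_sqrt h7
    rw [Real.sqrt_sq (by positivity)] at this
    linarith
  have hly : Tendsto (fun r => Real.log (y r)) atTop atTop := Real.tendsto_log_atTop.comp hy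
  have hL : Tendsto (fun r : ℕ => Real.log (r : ℝ)) atTop atTop :=
    Real.tendsto_log_atTop.comp hcast
  have hw : Tendsto (fun r : ℕ => y r * Real.log (y r) / r) atTop (nhds 1) := by
    refine ((Real.tendsto_mul_log_one_add_div_atTop 1).comp hy).congr' ?_
    filter_upwards [eventually_ge_atTop 1] with r hr
    obtain ⟨h0, h2⟩ := key r hr
    have : (0:ℝ) < r := by exact_mod_cast hr
    rw [h2]
    simp only [Function.comp]
    field_simp
  have hlw : Tendsto (fun r : ℕ => Real.log (y r * Real.log (y r) / r)) atTop (nhds 0) := by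
    have := hw.log one_ne_zero
    rwa [Real.log_one] at this
  have hll : Tendsto (fun r => Real.log (Real.log (y r)) / Real.log (y r)) atTop (nhds 0) :=
    (Real.isLittleO_log_id_atTop.tendsto_div_nhds_zero).comp hly
  have hq : Tendsto (fun r : ℕ => Real.log (r:ℝ) / Real.log (y r)) atTop (nhds 1) := by
    have h : Tendsto (fun r : ℕ => 1 + Real.log (Real.log (y r)) / Real.log (y r)
        - Real.log (y r * Real.log (y r) / r) / Real.log (y r)) atTop (nhds (1 + 0 - 0)) :=
      (hll.const_add 1).sub (hlw.div_atTop hly)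
    rw [add_zero, sub_zero] at h
    refine h.congr' ?_
    filter_upwards [eventually_ge_atTop 1, hly.eventually_gt_atTop 0] with r hr hl
    obtain ⟨h0, -⟩ := key r hr
    have : (0:ℝ) < r := by exact_mod_cast hr
    rw [Real.log_div (by positivity) this.ne', Real.log_mul h0.ne' hl.ne']
    field_simp
    ring
  have hu : Tendsto (fun r : ℕ => y r * Real.log (r:ℝ) / r) atTop (nhds 1) := by
    have h := hw.mul hq
    rw [mul_one] at h
    refine h.congr' ?_
    filter_upwards [hly.eventually_gt_atTop 0] with r hl
    field_simp
  have hfin : Tendsto (fun r : ℕ => (y r * Real.log (r:ℝ) / r)^2 /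
      ((y r * Real.log (r:ℝ) / r) / Real.log (r:ℝ) + 1 + 1 / (r:ℝ))) atTop
      (nhds (1^2 / (0 + 1 + 0))) :=
    (hu.pow 2).div (((hu.div_atTop hL).add_const 1).add
      (tendsto_const_nhds.div_atTop hcast)) (by norm_num)
  have e : (1:ℝ)^2 / (0 + 1 + 0) = 1 := by norm_num
  rw [e] at hfin
  refine hfin.congr' ?_
  filter_upwards [eventually_ge_atTop 1, hL.eventually_gt_atTop 0] with r hr hl
  obtain ⟨h0, -⟩ := key r hr
  have : (0:ℝ) < r := by exact_mod_cast hr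
  rw [mul_comm 2 r, pow_mul, ← hyd]
  have h1 : y r + r + 1 ≠ 0 := by positivity
  field_simp
end

section
/- Let r ≥ 1 be an integer and let T be a tree containing a vertex v with two pendant paths attached at v: vertices v^1_1, …, v^1_{p_1} forming a path with v^1_1 adjacent to v, and vertices v^2_1, …, v^2_{p_2} forming a path with v^2_1 adjacent to v, where v^1_{p_1} and v^2_{p_2} are leaves of T and all v^i_j have degree 2 in T except the leaf endpoints. Suppose p_1 + p_2 ≤ r + 1 and p_1 ≥ p_2. Let T' be the tree obtained from T by deleting the edge v v^2_1 and adding the edge v^2_1 v^1_{p_1}. Then T' has at least as many r-matchings as T. Moreover, if T has exactly three leaves and at least r+3 vertices, then T' has strictly more r-matchings than T. -/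
open SimpleGraph Filter

section helpers

variable {V : Type*}

lemma le_edgeDist_iff_s11 (G : SimpleGraph V) (r : ℕ) (e f : Sym2 V) :
    r ≤ edgeDist G e f ↔ ∀ u ∈ e, ∀ w ∈ f, r ≤ G.dist u w := by
  unfold edgeDist
  have hne : {d : ℕ | ∃ u ∈ e, ∃ w ∈ f, G.dist u w = d}.Nonempty := by
    induction e using Sym2.ind with
    | _ x y =>
      induction f using Sym2.ind with
      | _ z t => exact ⟨_, x, by simp, z, by simp, rfl⟩
  rw [le_csInf_iff (OrderBot.bddBelow _) hne]
  constructor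
  · intro H u hu w hw
    exact H _ ⟨u, hu, w, hw, rfl⟩
  · rintro H _ ⟨u, hu, w, hw, rfl⟩
    exact H u hu w hw

lemma lip_dist {G : SimpleGraph V} (hG : G.Connected) (f : V → ℕ)
    (hf : ∀ x y, G.Adj x y → f y ≤ f x + 1) (u w : V) : f w ≤ f u + G.dist u w := by
  obtain ⟨p, hp⟩ := hG.exists_walk_length_eq_dist u w
  rw [← hp]
  clear hp
  induction p with
  | nil => simp
  | cons h p ih =>
    have := hf _ _ h
    simp only [Walk.length_cons]
    omega

lemma adj_dist_le {G : SimpleGraph V} (hG : G.Connected) (u : V) {x y : V} (h : G.Adj x y) :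
    G.dist u y ≤ G.dist u x + 1 := by
  have := hG.dist_triangle (u := u) (v := x) (w := y)
  have h1 : G.dist x y = 1 := dist_eq_one_iff_adj.2 h
  omega

lemma exists_parent {G : SimpleGraph V} (hG : G.Connected) (u z : V) (hz : z ≠ u) :
    ∃ w, G.Adj w z ∧ G.dist u z = G.dist u w + 1 := by
  obtain ⟨p, hp⟩ := hG.exists_walk_length_eq_dist z u
  cases p with
  | nil => exact absurd rfl hz
  | @cons _ w _ h p =>
    refine ⟨w, h.symm, ?_⟩
    simp only [Walk.length_cons] at hp
    have h1 := dist_le p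
    have h2 := adj_dist_le hG u h.symm
    rw [dist_comm] at h1 hp
    omega

lemma parent_unique {G : SimpleGraph V} (hG : G.IsTree) {u z w₁ w₂ : V}
    (h1 : G.Adj w₁ z) (h2 : G.Adj w₂ z) (d1 : G.dist u z = G.dist u w₁ + 1)
    (d2 : G.dist u z = G.dist u w₂ + 1) : w₁ = w₂ := by
  obtain ⟨p, hp⟩ := hG.connected.exists_walk_length_eq_dist u w₁
  obtain ⟨q, hq⟩ := hG.connected.exists_walk_length_eq_dist u w₂
  have e1 : (p.concat h1).IsPath :=
    Walk.isPath_of_length_eq_dist _ (by rw [Walk.length_concat]; omega)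
  have e2 : (q.concat h2).IsPath :=
    Walk.isPath_of_length_eq_dist _ (by rw [Walk.length_concat]; omega)
  have := hG.isAcyclic.path_unique ⟨_, e1⟩ ⟨_, e2⟩
  have := congrArg (fun x : G.Path u z => x.1.penultimate) this
  simpa using this

/-- common descendant at same level forces equality -/
lemma anc_unique {G : SimpleGraph V} (hG : G.IsTree) {u x y : V} (n : ℕ) :
    ∀ z, G.dist x z = n → G.dist u z = G.dist u x + G.dist x z →
      G.dist u z = G.dist u y + G.dist y z → G.dist u x = G.dist u y → x = y := by
  induction n with
  | zero =>
    intro z hz h1 h2 h3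
    have e1 : x = z := hG.connected.dist_eq_zero_iff.1 hz
    have e2 : y = z := hG.connected.dist_eq_zero_iff.1 (by omega)
    rw [e1, e2]
  | succ n ih =>
    intro z hz h1 h2 h3
    have hzx : z ≠ x := by rintro rfl; simp at hz
    have hzy : z ≠ y := by
      rintro rfl; simp at h2; omega
    obtain ⟨w, hw, dw⟩ := exists_parent hG.connected x z hzx
    obtain ⟨w', hw', dw'⟩ := exists_parent hG.connected y z hzy
    have t1 := hG.connected.dist_triangle (u := u) (v := x) (w := w)
    have t2 := hG.connected.dist_triangle (u := u) (v := y) (w := w')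
    have l1 := adj_dist_le hG.connected u hw
    have l2 := adj_dist_le hG.connected u hw'
    have : w = w' := parent_unique hG hw hw' (u := u) (by omega) (by omega)
    subst this
    exact ih w (by omega) (by omega) (by omega) h3

lemma exists_child {G : SimpleGraph V} [Fintype V] [DecidableRel G.Adj] (hG : G.IsTree) {u z : V}
    (hz : z ≠ u) (hd : G.degree z ≠ 1) : ∃ w, G.Adj z w ∧ G.dist u w = G.dist u z + 1 := by
  classical
  obtain ⟨p, hp, dp⟩ := exists_parent hG.connected u z hz
  by_contra hcon
  push Not at hcon
  apply hd
  rw [← card_neighborFinset_eq_degree, Finset.card_eq_one]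
  refine ⟨p, ?_⟩
  ext w
  simp only [mem_neighborFinset, Finset.mem_singleton]
  constructor
  · intro hw
    have h1 := hcon w hw
    have := hG.dist_eq_dist_add_one_of_adj u hw
    exact parent_unique hG hw.symm hp (u := u) (by omega) dp
  · rintro rfl; exact hp.symm

lemma nb_two {G : SimpleGraph V} [Fintype V] [DecidableRel G.Adj] {c x y w : V}
    (hd : G.degree c = 2) (hx : G.Adj c x) (hy : G.Adj c y) (hxy : x ≠ y) (hw : G.Adj c w) :
    w = x ∨ w = y := by
  classical
  have : ({x, y} : Finset V) = G.neighborFinset c := by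
    apply Finset.eq_of_subset_of_card_le
    · intro t; simp only [Finset.mem_insert, Finset.mem_singleton, mem_neighborFinset]
      rintro (rfl | rfl) <;> assumption
    · rw [card_neighborFinset_eq_degree, hd, Finset.card_pair hxy]
  have h : w ∈ G.neighborFinset c := by simpa using hw
  rw [← this] at h
  simpa using h

lemma nb_one {G : SimpleGraph V} [Fintype V] [DecidableRel G.Adj] {c x w : V}
    (hd : G.degree c = 1) (hx : G.Adj c x) (hw : G.Adj c w) : w = x := by
  classical
  rw [← card_neighborFinset_eq_degree] at hd
  exact Finset.card_le_one.1 hd.le w (by simpa using hw) x (by simpa using hx)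

structure Surg (G : SimpleGraph V) (p q : ℕ) (v : V) (A B : ℕ → V) (h : V → ℕ) : Prop where
  conn : G.Connected
  hp : 1 ≤ p
  hq : 1 ≤ q
  A0 : A 0 = v
  B0 : B 0 = v
  hA : ∀ i ≤ p, h (A i) = i
  hB : ∀ j < q, h (B (j + 1)) = p + j + 1
  cov : ∀ x, h x = 0 ∨ (∃ i < p, x = A (i + 1)) ∨ ∃ j < q, x = B (j + 1)
  adjA : ∀ i < p, G.Adj (A i) (A (i + 1))
  adjB : ∀ i < q, G.Adj (B i) (B (i + 1))
  nbA : ∀ i < p, ∀ y, G.Adj (A (i + 1)) y → y = A i ∨ (i + 1 < p ∧ y = A (i + 2))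
  nbB : ∀ i < q, ∀ y, G.Adj (B (i + 1)) y → y = B i ∨ (i + 1 < q ∧ y = B (i + 2))

/-- the new graph -/
def newG (G : SimpleGraph V) (v b c : V) : SimpleGraph V :=
  G.deleteEdges {s(v, b)} ⊔ SimpleGraph.fromEdgeSet {s(b, c)}

namespace Surg

variable {G : SimpleGraph V} {p q : ℕ} {v : V} {A B : ℕ → V} {h : V → ℕ}

lemma hv (H : Surg G p q v A B h) : h v = 0 := by
  rw [← H.A0]; exact H.hA 0 (by omega)

lemma edge_cases (H : Surg G p q v A B h) {x y : V} (hxy : G.Adj x y) :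
    (h x = 0 ∧ h y = 0) ∨ (∃ i < p, s(x, y) = s(A i, A (i + 1))) ∨
      ∃ j < q, s(x, y) = s(B j, B (j + 1)) := by
  have key : ∀ x y, G.Adj x y → h x ≠ 0 → (∃ i < p, s(x, y) = s(A i, A (i + 1))) ∨
      ∃ j < q, s(x, y) = s(B j, B (j + 1)) := by
    intro x y hxy hx
    rcases H.cov x with h0 | ⟨i, hi, rfl⟩ | ⟨i, hi, rfl⟩
    · exact absurd h0 hx
    · left
      rcases H.nbA i hi y hxy with rfl | ⟨h1, rfl⟩
      · exact ⟨i, hi, Sym2.eq_swap⟩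
      · exact ⟨i + 1, h1, rfl⟩
    · right
      rcases H.nbB i hi y hxy with rfl | ⟨h1, rfl⟩
      · exact ⟨i, hi, Sym2.eq_swap⟩
      · exact ⟨i + 1, h1, rfl⟩
  by_cases hx : h x = 0
  · by_cases hy : h y = 0
    · exact Or.inl ⟨hx, hy⟩
    · right
      rw [Sym2.eq_swap]
      exact key y x hxy.symm hy
  · exact Or.inr (key x y hxy hx)

lemma B1_ne (H : Surg G p q v A B h) : B 1 ≠ A p := by
  intro e
  have h1 := H.hA p le_rfl
  have h2 := H.hB 0 H.hq
  rw [← e] at h1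
  simp only [zero_add] at h2
  omega

lemma not_adj (H : Surg G p q v A B h) : ¬ G.Adj (B 1) (A p) := by
  intro e
  have h1 := H.hA p le_rfl
  have h3 := H.hp
  rcases H.nbB 0 H.hq _ e with h2 | ⟨h4, h2⟩
  · rw [h2, H.B0, H.hv] at h1; omega
  · have := H.hB 1 h4
    rw [h2] at h1
    simp only [zero_add] at h1
    simp only [Nat.reduceAdd] at this
    omega

lemma new_adj (H : Surg G p q v A B h) (x y : V) : (newG G v (B 1) (A p)).Adj x y ↔
    (G.Adj x y ∧ s(x, y) ≠ s(v, B 1)) ∨ s(x, y) = s(B 1, A p) := by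
  have hne := H.B1_ne
  simp only [newG, sup_adj, deleteEdges_adj, fromEdgeSet_adj, Set.mem_singleton_iff, ne_eq]
  constructor
  · rintro (h | ⟨h, _⟩)
    · exact Or.inl h
    · exact Or.inr h
  · rintro (h | h)
    · exact Or.inl h
    · refine Or.inr ⟨h, ?_⟩
      rintro rfl
      rcases Sym2.eq_iff.1 h with ⟨h1, h2⟩ | ⟨h1, h2⟩
      · exact hne (h1.symm.trans h2)
      · exact hne (h2.symm.trans h1)

lemma chain {G : SimpleGraph V} (hG : G.Connected) (A : ℕ → V) (p : ℕ)
    (adjA : ∀ i < p, G.Adj (A i) (A (i + 1))) (i k : ℕ) (hk : i + k ≤ p) :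
    G.dist (A i) (A (i + k)) ≤ k := by
  induction k with
  | zero => simp
  | succ k ih =>
    have h1 := ih (by omega)
    have h2 := adj_dist_le hG (A i) (adjA (i + k) (by omega))
    rw [← add_assoc]
    omega

lemma chain' {G : SimpleGraph V} (hG : G.Connected) (A : ℕ → V) (p : ℕ)
    (adjA : ∀ i < p, G.Adj (A i) (A (i + 1))) (i j : ℕ) (hi : i < p) (hj : j < p) :
    G.dist (A i) (A j) < p := by
  rcases le_total i j with hij | hij
  · obtain ⟨k, rfl⟩ := Nat.exists_eq_add_of_le hij
    have := chain hG A p adjA i k (by omega)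
    omega
  · obtain ⟨k, rfl⟩ := Nat.exists_eq_add_of_le hij
    have := chain hG A p adjA j k (by omega)
    rw [dist_comm]
    omega

lemma dvA (H : Surg G p q v A B h) (i : ℕ) (hi : i ≤ p) : G.dist v (A i) ≤ i := by
  have := chain H.conn A p H.adjA 0 i (by omega)
  rwa [H.A0, zero_add] at this

lemma dvB (H : Surg G p q v A B h) (i : ℕ) (hi : i ≤ q) : G.dist v (B i) ≤ i := by
  have := chain H.conn B q H.adjB 0 i (by omega)
  rwa [H.B0, zero_add] at this

lemma not_special_A (H : Surg G p q v A B h) (i : ℕ) (hi : i < p) :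
    s(A i, A (i + 1)) ≠ s(v, B 1) := by
  intro e
  have h1 := H.hA i (by omega)
  have h2 := H.hA (i + 1) (by omega)
  have h3 := H.hB 0 H.hq
  simp only [zero_add] at h3
  rcases Sym2.eq_iff.1 e with ⟨e1, e2⟩ | ⟨e1, e2⟩
  · rw [e2] at h2; omega
  · rw [e1] at h1; omega

lemma special_B (H : Surg G p q v A B h) (j : ℕ) (hj : j < q)
    (e : s(B j, B (j + 1)) = s(v, B 1)) : j = 0 := by
  have h1 := H.hB j hj
  have h3 := H.hB 0 H.hq
  have h4 := H.hv
  simp only [zero_add] at h3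
  rcases Sym2.eq_iff.1 e with ⟨e1, e2⟩ | ⟨e1, e2⟩
  · rw [e2] at h1; omega
  · rw [e2] at h1; omega

lemma not_special_S (H : Surg G p q v A B h) {x y : V} (hx : h x = 0) (hy : h y = 0) :
    s(x, y) ≠ s(v, B 1) := by
  intro e
  have h3 := H.hB 0 H.hq
  simp only [zero_add] at h3
  rcases Sym2.eq_iff.1 e with ⟨e1, e2⟩ | ⟨e1, e2⟩
  · rw [e2] at hy; omega
  · rw [e1] at hx; omega

open Classical in
/-- retraction onto the base -/
noncomputable def rho (v : V) (h : V → ℕ) (x : V) : V := if h x = 0 then x else v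

lemma rho_zero {x : V} (hx : h x = 0) : rho v h x = x := if_pos hx
lemma rho_pos {x : V} (hx : h x ≠ 0) : rho v h x = v := if_neg hx
lemma rho_A (H : Surg G p q v A B h) (i : ℕ) (hi : i ≤ p) : rho v h (A i) = v := by
  rcases Nat.eq_zero_or_pos i with rfl | h0
  · rw [H.A0, rho_zero H.hv]
  · rw [rho_pos]; rw [H.hA i hi]; omega
lemma rho_B (H : Surg G p q v A B h) (i : ℕ) (hi : i ≤ q) : rho v h (B i) = v := by
  rcases i with _ | i
  · rw [H.B0, rho_zero H.hv]
  · rw [rho_pos]; rw [H.hB i hi]; omega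

lemma new_conn (H : Surg G p q v A B h) : (newG G v (B 1) (A p)).Connected := by
  set G' := newG G v (B 1) (A p) with hG'
  have r1 : ∀ x z, G'.Reachable (rho v h x) (rho v h z) := by
    intro x z
    obtain ⟨w⟩ := H.conn x z
    induction w with
    | nil => exact Reachable.refl _
    | @cons x y z hxy w ih =>
      refine Reachable.trans ?_ ih
      rcases H.edge_cases hxy with ⟨hx, hy⟩ | ⟨i, hi, e⟩ | ⟨i, hi, e⟩
      · rw [rho_zero hx, rho_zero hy]
        exact Adj.reachable ((H.new_adj x y).2 (Or.inl ⟨hxy, H.not_special_S hx hy⟩))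
      · rcases Sym2.eq_iff.1 e with ⟨rfl, rfl⟩ | ⟨rfl, rfl⟩ <;>
          rw [H.rho_A i (by omega), H.rho_A (i + 1) (by omega)]
      · rcases Sym2.eq_iff.1 e with ⟨rfl, rfl⟩ | ⟨rfl, rfl⟩ <;>
          rw [H.rho_B i (by omega), H.rho_B (i + 1) (by omega)]
  have rA : ∀ i ≤ p, G'.Reachable v (A i) := by
    intro i
    induction i with
    | zero => intro _; rw [H.A0]
    | succ i ih =>
      intro hi
      exact (ih (by omega)).trans (Adj.reachable ((H.new_adj _ _).2
        (Or.inl ⟨H.adjA i hi, H.not_special_A i hi⟩)))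
  have rB : ∀ j < q, G'.Reachable v (B (j + 1)) := by
    intro j
    induction j with
    | zero =>
      intro _
      exact (rA p le_rfl).trans (Adj.reachable ((H.new_adj _ _).2 (Or.inr Sym2.eq_swap)))
    | succ j ih =>
      intro hj
      refine (ih (by omega)).trans (Adj.reachable ((H.new_adj _ _).2
        (Or.inl ⟨H.adjB _ hj, fun e => ?_⟩)))
      have := H.special_B _ hj e
      omega
  have rv : ∀ x, G'.Reachable v x := by
    intro x
    rcases H.cov x with h0 | ⟨i, hi, rfl⟩ | ⟨i, hi, rfl⟩
    · have := r1 v x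
      rwa [rho_zero h0, rho_zero H.hv] at this
    · exact rA _ hi
    · exact rB _ hi
  haveI : Nonempty V := ⟨v⟩
  exact ⟨fun x y => (rv x).symm.trans (rv y)⟩

/-- lower bound for distances in the new graph -/
lemma new_lower (H : Surg G p q v A B h) {u : V} (hu : h u = 0) (w : V) :
    G.dist u (rho v h w) + h w ≤ (newG G v (B 1) (A p)).dist u w := by
  have := lip_dist H.new_conn (fun x => G.dist u (rho v h x) + h x) ?_ u w
  · simpa [rho_zero hu, hu] using this
  · have key : ∀ x y c d, s(x, y) = s(c, d) → rho v h c = v → rho v h d = v →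
        h d = h c + 1 → G.dist u (rho v h y) + h y ≤ G.dist u (rho v h x) + h x + 1 := by
      intro x y c d e hc hd hh
      rcases Sym2.eq_iff.1 e with ⟨rfl, rfl⟩ | ⟨rfl, rfl⟩ <;> rw [hc, hd] <;> omega
    intro x y hxy
    rcases (H.new_adj x y).1 hxy with ⟨hxy, hne⟩ | e
    · rcases H.edge_cases hxy with ⟨hx, hy⟩ | ⟨i, hi, e⟩ | ⟨i, hi, e⟩
      · have := adj_dist_le H.conn u hxy
        simp only [rho_zero hx, rho_zero hy, hx, hy]
        omega
      · exact key _ _ _ _ e (H.rho_A _ (by omega)) (H.rho_A _ (by omega))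
          (by rw [H.hA _ (by omega), H.hA _ (by omega)])
      · rcases i with _ | i
        · exact absurd (by rw [e, H.B0]) hne
        · exact key _ _ _ _ e (H.rho_B _ (by omega)) (H.rho_B _ (by omega))
            (by rw [H.hB _ (by omega), H.hB _ (by omega)]; omega)
    · exact key _ _ _ _ (e.trans Sym2.eq_swap) (H.rho_A _ le_rfl) (H.rho_B _ H.hq)
        (by rw [H.hA _ le_rfl]; have := H.hB 0 H.hq; simpa using this)

lemma old_upper (H : Surg G p q v A B h) (u w : V) :
    G.dist u w ≤ G.dist u (rho v h w) + h w := by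
  rcases H.cov w with h0 | ⟨i, hi, rfl⟩ | ⟨i, hi, rfl⟩
  · rw [rho_zero h0]; omega
  · rw [H.rho_A _ hi, H.hA _ hi]
    have := H.dvA (i + 1) hi
    have := H.conn.dist_triangle (u := u) (v := v) (w := A (i + 1))
    omega
  · rw [H.rho_B _ hi, H.hB _ hi]
    have := H.dvB (i + 1) hi
    have := H.conn.dist_triangle (u := u) (v := v) (w := B (i + 1))
    omega

lemma mono (H : Surg G p q v A B h) {u : V} (hu : h u = 0) (w : V) :
    G.dist u w ≤ (newG G v (B 1) (A p)).dist u w :=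
  (H.old_upper u w).trans (H.new_lower hu w)

open Classical in
/-- edge bijection -/
noncomputable def sig (v b c : V) (e : Sym2 V) : Sym2 V := if e = s(v, b) then s(b, c) else e

lemma sig_inj (H : Surg G p q v A B h) {e f : Sym2 V} (he : e ∈ G.edgeSet) (hf : f ∈ G.edgeSet)
    (hef : sig v (B 1) (A p) e = sig v (B 1) (A p) f) : e = f := by
  have hn : s(B 1, A p) ∉ G.edgeSet := H.not_adj
  unfold sig at hef
  split_ifs at hef with h1 h2 h2
  · rw [h1, h2]
  · exact absurd (hef ▸ hf) hn
  · exact absurd (hef ▸ he) hn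
  · exact hef

lemma sig_mem (H : Surg G p q v A B h) {e : Sym2 V} (he : e ∈ G.edgeSet) :
    sig v (B 1) (A p) e ∈ (newG G v (B 1) (A p)).edgeSet := by
  unfold sig
  split_ifs with h1
  · exact (H.new_adj _ _).2 (Or.inr rfl)
  · induction e using Sym2.ind with
    | _ x y => exact (H.new_adj _ _).2 (Or.inl ⟨he, h1⟩)

lemma dist_S (H : Surg G p q v A B h) {r : ℕ} {e f : Sym2 V}
    (he : ∀ u ∈ e, h u = 0) (hd : ∀ u ∈ e, ∀ w ∈ f, r ≤ G.dist u w) :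
    ∀ u ∈ e, ∀ w ∈ sig v (B 1) (A p) f, r ≤ (newG G v (B 1) (A p)).dist u w := by
  intro u hu w hw
  unfold sig at hw
  split_ifs at hw with h1
  · subst h1
    have h2 := hd u hu v (by simp)
    have h3 := H.new_lower (he u hu) w
    have h4 : rho v h w = v := by
      rcases Sym2.mem_iff.1 hw with rfl | rfl
      · exact H.rho_B _ H.hq
      · exact H.rho_A _ le_rfl
    rw [h4] at h3
    omega
  · exact (hd u hu w hw).trans (H.mono (he u hu) w)

lemma sig_S (H : Surg G p q v A B h) {e : Sym2 V} (he : ∀ u ∈ e, h u = 0) :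
    sig v (B 1) (A p) e = e := by
  unfold sig
  rw [if_neg]
  rintro rfl
  have h3 := H.hB 0 H.hq
  have := he (B 1) (by simp)
  simp only [zero_add] at h3
  omega

lemma cases' (H : Surg G p q v A B h) {e : Sym2 V} (he : e ∈ G.edgeSet) :
    (∀ u ∈ e, h u = 0) ∨ (∃ i < p, A i ∈ e) ∨ ∃ j < q, B j ∈ e := by
  induction e using Sym2.ind with
  | _ x y =>
    rcases H.edge_cases he with ⟨hx, hy⟩ | ⟨i, hi, e⟩ | ⟨i, hi, e⟩
    · left
      intro u hu
      rcases Sym2.mem_iff.1 hu with rfl | rfl <;> assumption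
    · exact Or.inr (Or.inl ⟨i, hi, by rw [e]; simp⟩)
    · exact Or.inr (Or.inr ⟨i, hi, by rw [e]; simp⟩)

lemma main_dist (H : Surg G p q v A B h) {r : ℕ} (hr : p + q ≤ r + 1) {e f : Sym2 V}
    (he : e ∈ G.edgeSet) (hf : f ∈ G.edgeSet) (hd : r ≤ edgeDist G e f) :
    r ≤ edgeDist (newG G v (B 1) (A p)) (sig v (B 1) (A p) e) (sig v (B 1) (A p) f) := by
  rw [le_edgeDist_iff_s11] at hd ⊢
  have hp := H.hp
  have hq := H.hq
  have hAB : ∀ i < p, ∀ j < q, G.dist (A i) (B j) < r := by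
    intro i hi j hj
    have h1 := H.dvA i hi.le
    have h2 := H.dvB j hj.le
    have h3 := H.conn.dist_triangle (u := A i) (v := v) (w := B j)
    rw [dist_comm] at h1
    omega
  rcases H.cases' he with h1 | h1 | h1
  · rw [H.sig_S h1]
    exact H.dist_S h1 hd
  all_goals
    rcases H.cases' hf with h2 | h2 | h2
    · rw [H.sig_S h2]
      intro u hu w hw
      rw [dist_comm]
      refine H.dist_S h2 (f := e) ?_ w hw u hu
      intro u hu w hw
      rw [dist_comm]
      exact hd w hw u hu
  · obtain ⟨i, hi, h1⟩ := h1
    obtain ⟨j, hj, h2⟩ := h2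
    have := hd _ h1 _ h2
    have := chain' H.conn A p H.adjA i j hi hj
    omega
  · obtain ⟨i, hi, h1⟩ := h1
    obtain ⟨j, hj, h2⟩ := h2
    have := hd _ h1 _ h2
    have := hAB i hi j hj
    omega
  · obtain ⟨i, hi, h1⟩ := h1
    obtain ⟨j, hj, h2⟩ := h2
    have := hd _ h1 _ h2
    have := hAB j hj i hi
    rw [dist_comm] at this
    omega
  · obtain ⟨i, hi, h1⟩ := h1
    obtain ⟨j, hj, h2⟩ := h2
    have := hd _ h1 _ h2
    have := chain' H.conn B q H.adjB i j hi hj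
    omega

open Classical in
lemma image_matching (H : Surg G p q v A B h) {r : ℕ} (hr : p + q ≤ r + 1)
    {M : Finset (Sym2 V)} (hM : IsRMatching G r M) :
    IsRMatching (newG G v (B 1) (A p)) r (M.image (sig v (B 1) (A p))) := by
  constructor
  · intro e₀ he₀
    obtain ⟨e, he, rfl⟩ := Finset.mem_image.1 he₀
    exact H.sig_mem (hM.1 e he)
  · intro e₀ he₀ f₀ hf₀ hne
    obtain ⟨e, he, rfl⟩ := Finset.mem_image.1 he₀
    obtain ⟨f, hf, rfl⟩ := Finset.mem_image.1 hf₀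
    exact H.main_dist hr (hM.1 e he) (hM.1 f hf)
      (hM.2 e he f hf (fun h => hne (by rw [h])))

open Classical in
/-- the injection on matchings -/
noncomputable def mp (H : Surg G p q v A B h) {r : ℕ} (hr : p + q ≤ r + 1)
    (M : {M : Finset (Sym2 V) // IsRMatching G r M}) :
    {M : Finset (Sym2 V) // IsRMatching (newG G v (B 1) (A p)) r M} :=
  ⟨M.1.image (sig v (B 1) (A p)), H.image_matching hr M.2⟩

lemma mem_of_mem_mp (H : Surg G p q v A B h) {r : ℕ} (hr : p + q ≤ r + 1)
    (M : {M : Finset (Sym2 V) // IsRMatching G r M}) {e : Sym2 V} (he : e ∈ G.edgeSet)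
    (hm : sig v (B 1) (A p) e ∈ (H.mp hr M).1) : e ∈ M.1 := by
  classical
  obtain ⟨f, hf, hfe⟩ := Finset.mem_image.1 hm
  rwa [← H.sig_inj (M.2.1 f hf) he hfe]

lemma mp_inj (H : Surg G p q v A B h) {r : ℕ} (hr : p + q ≤ r + 1) :
    Function.Injective (H.mp hr) := by
  classical
  intro M N hMN
  apply Subtype.ext
  ext e
  constructor
  · intro he
    exact H.mem_of_mem_mp hr N (M.2.1 e he) (hMN ▸ Finset.mem_image_of_mem _ he)
  · intro he
    exact H.mem_of_mem_mp hr M (N.2.1 e he) (hMN ▸ Finset.mem_image_of_mem _ he)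

lemma weak [Fintype V] (H : Surg G p q v A B h) {r : ℕ} (hr : p + q ≤ r + 1) :
    numRMatchings G r ≤ numRMatchings (newG G v (B 1) (A p)) r :=
  Nat.card_le_card_of_injective _ (H.mp_inj hr)

/-- strictness from an edge of the base at the right distance -/
lemma strict [Fintype V] (H : Surg G p q v A B h) {r : ℕ} (hr : p + q ≤ r + 1)
    {x y : V} (hxy : G.Adj x y) (hx : h x = 0) (hy : h y = 0)
    (dx : G.dist v x = r + 1 - (p + q)) (dy : G.dist v y = G.dist v x + 1) :
    numRMatchings G r < numRMatchings (newG G v (B 1) (A p)) r := by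
  classical
  have hp := H.hp
  obtain ⟨q, rfl⟩ : ∃ k, q = k + 1 := ⟨q - 1, by have := H.hq; omega⟩
  unfold numRMatchings
  rw [Nat.card_eq_fintype_card, Nat.card_eq_fintype_card]
  set e := s(x, y) with he
  set f := s(B q, B (q + 1)) with hf
  have hf' : f ∈ G.edgeSet := H.adjB q (by omega)
  have he' : e ∈ G.edgeSet := hxy
  have heS : ∀ u ∈ e, h u = 0 := by
    intro u hu
    rcases Sym2.mem_iff.1 hu with rfl | rfl <;> assumption
  have hw : ∀ w ∈ sig v (B 1) (A p) f, rho v h w = v ∧ p + q ≤ h w := by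
    intro w hw
    unfold sig at hw
    split_ifs at hw with h1
    · have := H.special_B q (by omega) h1
      subst this
      rcases Sym2.mem_iff.1 hw with rfl | rfl
      · have := H.hB 0 (by omega)
        exact ⟨H.rho_B _ (by omega), by simp only [zero_add] at this; omega⟩
      · exact ⟨H.rho_A _ le_rfl, by rw [H.hA _ le_rfl]; omega⟩
    · rcases Sym2.mem_iff.1 hw with rfl | rfl
      · refine ⟨H.rho_B _ (by omega), ?_⟩
        rcases q with _ | q
        · exact absurd (by rw [hf, H.B0]) h1
        · rw [H.hB _ (by omega)]; omega
      · exact ⟨H.rho_B _ (by omega), by rw [H.hB _ (by omega)]; omega⟩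
  have hD : ∀ u ∈ e, ∀ w ∈ sig v (B 1) (A p) f, r ≤ (newG G v (B 1) (A p)).dist u w := by
    intro u hu w hw'
    obtain ⟨h1, h2⟩ := hw w hw'
    have h3 := H.new_lower (heS u hu) w
    rw [h1, dist_comm] at h3
    rcases Sym2.mem_iff.1 hu with rfl | rfl <;> omega
  have hmatch : IsRMatching (newG G v (B 1) (A p)) r {sig v (B 1) (A p) e, sig v (B 1) (A p) f} := by
    have hse := H.sig_S heS
    constructor
    · intro g hg
      simp only [Finset.mem_insert, Finset.mem_singleton] at hg
      rcases hg with rfl | rfl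
      · exact H.sig_mem he'
      · exact H.sig_mem hf'
    · intro g hg k hk hne
      rw [hse] at hg hk
      simp only [Finset.mem_insert, Finset.mem_singleton] at hg hk
      rw [le_edgeDist_iff_s11]
      rcases hg with rfl | rfl <;> rcases hk with rfl | rfl
      · exact absurd rfl hne
      · exact hD
      · intro u hu w hw
        rw [dist_comm]
        exact hD w hw u hu
      · exact absurd rfl hne
  refine Fintype.card_lt_of_injective_of_notMem (H.mp hr) (H.mp_inj hr) (b := ⟨_, hmatch⟩) ?_
  rintro ⟨M, hM⟩
  have h1 : e ∈ M.1 := H.mem_of_mem_mp hr M he' (by rw [hM]; simp)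
  have h2 : f ∈ M.1 := H.mem_of_mem_mp hr M hf' (by rw [hM]; simp)
  have hne : e ≠ f := by
    intro e1
    have := heS (B (q + 1)) (by rw [e1, hf]; simp)
    rw [H.hB _ (by omega)] at this
    omega
  have h3 := M.2.2 e h1 f h2 hne
  rw [le_edgeDist_iff_s11] at h3
  have h4 := h3 x (by simp [he]) (B q) (by simp [hf])
  have h5 := H.dvB q (by omega)
  have h6 := H.conn.dist_triangle (u := x) (v := v) (w := B q)
  rw [dist_comm (u := x) (v := v)] at h6
  omega

lemma S_nb (H : Surg G p q v A B h) {x y : V} (hx : h x = 0) (hxv : x ≠ v) (hxy : G.Adj x y) :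
    h y = 0 := by
  by_contra hy
  rcases H.cov y with h0 | ⟨i, hi, rfl⟩ | ⟨i, hi, rfl⟩
  · exact hy h0
  · rcases H.nbA i hi x hxy.symm with rfl | ⟨h1, rfl⟩
    · rw [H.hA _ (by omega)] at hx
      subst hx
      exact hxv H.A0
    · rw [H.hA _ (by omega)] at hx
      omega
  · rcases H.nbB i hi x hxy.symm with rfl | ⟨h1, rfl⟩
    · rcases i with _ | i
      · exact hxv H.B0
      · rw [H.hB _ (by omega)] at hx
        omega
    · rw [H.hB _ (by omega)] at hx
      omega

lemma find_edge (H : Surg G p q v A B h) (d n : ℕ) : ∀ z, h z = 0 → G.dist v z = d + 1 + n →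
    ∃ x y, G.Adj x y ∧ h x = 0 ∧ h y = 0 ∧ G.dist v x = d ∧ G.dist v y = G.dist v x + 1 := by
  induction n with
  | zero =>
    intro z hz hd
    have hzv : z ≠ v := by rintro rfl; simp at hd
    obtain ⟨w, hw, dw⟩ := exists_parent H.conn v z hzv
    exact ⟨w, z, hw, H.S_nb hz hzv hw.symm, hz, by omega, dw⟩
  | succ n ih =>
    intro z hz hd
    have hzv : z ≠ v := by rintro rfl; simp at hd
    obtain ⟨w, hw, dw⟩ := exists_parent H.conn v z hzv
    exact ih w (H.S_nb hz hzv hw.symm) (by omega)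

lemma find_leaf [Fintype V] [DecidableRel G.Adj] (H : Surg G p q v A B h) (hG : G.IsTree) {x : V}
    (hx : h x = 0) (hxv : x ≠ v) :
    ∃ z, h z = 0 ∧ G.degree z = 1 ∧ G.dist v z = G.dist v x + G.dist x z := by
  classical
  obtain ⟨z, hz, hmax⟩ := Finset.exists_max_image
    (Finset.univ.filter fun z => h z = 0 ∧ G.dist v z = G.dist v x + G.dist x z)
    (fun z => G.dist v z) ⟨x, by simp [hx]⟩
  simp only [Finset.mem_filter, Finset.mem_univ, true_and] at hz hmax
  refine ⟨z, hz.1, ?_, hz.2⟩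
  by_contra hd
  have hx0 := H.conn.pos_dist_of_ne hxv.symm
  have hzv : z ≠ v := by
    rintro rfl
    have := hz.2
    simp at this
    omega
  obtain ⟨w, hw, dw⟩ := exists_child hG hzv hd
  have h1 := adj_dist_le H.conn x hw
  have h2 := H.conn.dist_triangle (u := v) (v := x) (w := w)
  have := hmax w ⟨H.S_nb hz.1 hzv hw, by omega⟩
  omega

lemma strict' [Fintype V] [DecidableEq V] [DecidableRel G.Adj] (H : Surg G p q v A B h)
    (hG : G.IsTree)
    {r : ℕ} (hr : p + q ≤ r + 1) (hdA : G.degree (A p) = 1) (hdB : G.degree (B q) = 1)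
    (h3 : (Finset.univ.filter fun x => G.degree x = 1).card = 3) (hn : r + 3 ≤ Fintype.card V) :
    numRMatchings G r < numRMatchings (newG G v (B 1) (A p)) r := by
  have hp := H.hp
  have hq := H.hq
  suffices ∃ z, h z = 0 ∧ r + 1 - (p + q) + 1 ≤ G.dist v z by
    obtain ⟨z, hz, hd⟩ := this
    obtain ⟨n, hn⟩ := Nat.exists_eq_add_of_le hd
    obtain ⟨x, y, hxy, hx, hy, dx, dy⟩ := H.find_edge _ n z hz hn
    exact H.strict hr hxy hx hy dx dy
  by_contra hcon
  push Not at hcon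
  -- the base is large
  have hcard : r + 3 ≤ (Finset.univ.filter fun x => h x = 0).card + (p + q) := by
    have h1 := Finset.card_filter_add_card_filter_not (s := (Finset.univ : Finset V))
      (fun x => h x = 0)
    have h2 : (Finset.univ.filter fun x => ¬ h x = 0).card ≤ p + q := by
      have : (Finset.univ.filter fun x => ¬ h x = 0) ⊆
          (Finset.range p).image (fun i => A (i + 1)) ∪
          (Finset.range q).image (fun i => B (i + 1)) := by
        intro x hx
        simp only [Finset.mem_filter, Finset.mem_univ, true_and] at hx
        simp only [Finset.mem_union, Finset.mem_image, Finset.mem_range]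
        rcases H.cov x with h0 | ⟨i, hi, rfl⟩ | ⟨i, hi, rfl⟩
        · exact absurd h0 hx
        · exact Or.inl ⟨i, hi, rfl⟩
        · exact Or.inr ⟨i, hi, rfl⟩
      refine (Finset.card_le_card this).trans ((Finset.card_union_le _ _).trans ?_)
      refine Nat.add_le_add (Finset.card_image_le.trans (by simp))
        (Finset.card_image_le.trans (by simp))
    rw [Finset.card_univ] at h1
    omega
  obtain ⟨x, hx, y, hy, hxy, hd⟩ := Finset.exists_ne_map_eq_of_card_lt_of_maps_to
    (s := Finset.univ.filter fun x => h x = 0) (t := Finset.range (r + 1 - (p + q) + 1))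
    (f := fun x => G.dist v x) (by rw [Finset.card_range]; omega)
    (by
      intro x hx
      simp only [Finset.coe_filter, Finset.mem_univ, true_and, Set.mem_setOf_eq] at hx
      simpa using hcon x hx)
  simp only [Finset.mem_filter, Finset.mem_univ, true_and] at hx hy
  have hxv : x ≠ v := by
    rintro rfl
    simp only [dist_self] at hd
    exact hxy (H.conn.dist_eq_zero_iff.1 hd.symm)
  have hyv : y ≠ v := by
    rintro rfl
    simp only [dist_self] at hd
    exact hxy (H.conn.dist_eq_zero_iff.1 hd).symm
  obtain ⟨z, hz, dz, ez⟩ := H.find_leaf hG hx hxv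
  obtain ⟨t, ht, dt, et⟩ := H.find_leaf hG hy hyv
  have hzt : z ≠ t := by
    rintro rfl
    exact hxy (anc_unique hG _ z rfl ez et hd)
  obtain ⟨k, rfl⟩ : ∃ k, q = k + 1 := ⟨q - 1, by omega⟩
  have hhA := H.hA p le_rfl
  have hhB := H.hB k (by omega)
  have hsub : ({A p, B (k + 1), z, t} : Finset V) ⊆ Finset.univ.filter fun x => G.degree x = 1 := by
    intro w
    simp only [Finset.mem_insert, Finset.mem_singleton, Finset.mem_filter, Finset.mem_univ,
      true_and]
    rintro (rfl | rfl | rfl | rfl) <;> assumption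
  have hc := Finset.card_le_card hsub
  have n1 : A p ≠ B (k + 1) := by intro e; rw [e] at hhA; omega
  have n2 : A p ≠ z := by intro e; rw [e] at hhA; omega
  have n3 : A p ≠ t := by intro e; rw [e] at hhA; omega
  have n4 : B (k + 1) ≠ z := by intro e; rw [e] at hhB; omega
  have n5 : B (k + 1) ≠ t := by intro e; rw [e] at hhB; omega
  rw [h3, Finset.card_insert_of_notMem (by simp [n1, n2, n3]),
    Finset.card_insert_of_notMem (by simp [n4, n5]), Finset.card_pair hzt] at hc
  omega

end Surg
end helpers

/-- Lemma 2 surgery: let `T` be a tree with a vertex `v` carrying two pendant paths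
`v¹_1, …, v¹_{p₁}` and `v²_1, …, v²_{p₂}` (with `v¹_1, v²_1` adjacent to `v`, the far
endpoints leaves, and all internal path vertices of degree two), where `p₂ ≤ p₁` and
`p₁ + p₂ ≤ r + 1`.  Replacing the edge `v v²_1` by the edge `v²_1 v¹_{p₁}` yields a tree
`T'` with at least as many `r`-matchings as `T`; and if `T` has exactly three leaves and
at least `r + 3` vertices, then `T'` has strictly more `r`-matchings than `T`. -/
theorem stmt11 {V : Type*} [Fintype V] [DecidableEq V] (r : ℕ) (hr : 1 ≤ r)
    (G : SimpleGraph V) [DecidableRel G.Adj] (hG : G.IsTree)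
    (p₁ p₂ : ℕ) (hp₂ : 1 ≤ p₂) (hle : p₂ ≤ p₁) (hsum : p₁ + p₂ ≤ r + 1)
    (v : V) (a b : ℕ → V)
    (ha_inj : ∀ i < p₁, ∀ j < p₁, a i = a j → i = j)
    (hb_inj : ∀ i < p₂, ∀ j < p₂, b i = b j → i = j)
    (hab : ∀ i < p₁, ∀ j < p₂, a i ≠ b j)
    (hav : ∀ i < p₁, a i ≠ v) (hbv : ∀ j < p₂, b j ≠ v)
    (hva : G.Adj v (a 0)) (hvb : G.Adj v (b 0))
    (ha_adj : ∀ i, i + 1 < p₁ → G.Adj (a i) (a (i + 1)))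
    (hb_adj : ∀ i, i + 1 < p₂ → G.Adj (b i) (b (i + 1)))
    (ha_leaf : G.degree (a (p₁ - 1)) = 1)
    (hb_leaf : G.degree (b (p₂ - 1)) = 1)
    (ha_deg : ∀ i, i + 1 < p₁ → G.degree (a i) = 2)
    (hb_deg : ∀ i, i + 1 < p₂ → G.degree (b i) = 2) :
    numRMatchings G r ≤
      numRMatchings
        (G.deleteEdges {s(v, b 0)} ⊔ SimpleGraph.fromEdgeSet {s(b 0, a (p₁ - 1))}) r ∧
    ((Finset.univ.filter fun x => G.degree x = 1).card = 3 → r + 3 ≤ Fintype.card V →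
      numRMatchings G r <
        numRMatchings
          (G.deleteEdges {s(v, b 0)} ⊔ SimpleGraph.fromEdgeSet {s(b 0, a (p₁ - 1))}) r) := by
  classical
  obtain ⟨A, hAdef⟩ : ∃ A : ℕ → V, A = fun n => if n = 0 then v else a (n - 1) := ⟨_, rfl⟩
  obtain ⟨B, hBdef⟩ : ∃ B : ℕ → V, B = fun n => if n = 0 then v else b (n - 1) := ⟨_, rfl⟩
  have A0 : A 0 = v := by simp [hAdef]
  have B0 : B 0 = v := by simp [hBdef]
  have AS : ∀ i, A (i + 1) = a i := by simp [hAdef]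
  have BS : ∀ i, B (i + 1) = b i := by simp [hBdef]
  obtain ⟨P, rfl⟩ : ∃ k, p₁ = k + 1 := ⟨p₁ - 1, by omega⟩
  obtain ⟨Q, rfl⟩ : ∃ k, p₂ = k + 1 := ⟨p₂ - 1, by omega⟩
  simp only [Nat.add_sub_cancel] at ha_leaf hb_leaf ⊢
  obtain ⟨h, hh⟩ : ∃ h : V → ℕ, ∀ x, (∀ i < P + 1, x = a i → h x = i + 1) ∧
      (∀ j < Q + 1, x = b j → h x = P + 1 + j + 1) ∧
      (h x = 0 ∨ (∃ i < P + 1, x = a i) ∨ ∃ j < Q + 1, x = b j) := by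
    suffices hc : ∀ x, ∃ n : ℕ, (∀ i < P + 1, x = a i → n = i + 1) ∧
        (∀ j < Q + 1, x = b j → n = P + 1 + j + 1) ∧
        (n = 0 ∨ (∃ i < P + 1, x = a i) ∨ ∃ j < Q + 1, x = b j) by
      choose h hh using hc
      exact ⟨h, hh⟩
    intro x
    by_cases hx : ∃ i < P + 1, x = a i
    · obtain ⟨i, hi, rfl⟩ := hx
      refine ⟨i + 1, ?_, ?_, Or.inr (Or.inl ⟨i, hi, rfl⟩)⟩
      · intro j hj e; rw [ha_inj i hi j hj e]
      · intro j hj e; exact absurd e (hab i hi j hj)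
    · by_cases hx' : ∃ i < Q + 1, x = b i
      · obtain ⟨i, hi, rfl⟩ := hx'
        refine ⟨P + 1 + i + 1, ?_, ?_, Or.inr (Or.inr ⟨i, hi, rfl⟩)⟩
        · intro j hj e; exact absurd e.symm (hab j hj i hi)
        · intro j hj e; rw [hb_inj i hi j hj e]
      · exact ⟨0, fun i hi e => absurd ⟨i, hi, e⟩ hx, fun i hi e => absurd ⟨i, hi, e⟩ hx',
          Or.inl rfl⟩
  have hv0 : h v = 0 := by
    rcases (hh v).2.2 with h0 | ⟨i, hi, e⟩ | ⟨i, hi, e⟩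
    · exact h0
    · exact absurd e.symm (hav i hi)
    · exact absurd e.symm (hbv i hi)
  have nb : ∀ (c : ℕ → V) (C : ℕ → V) (K : ℕ), C 0 = v → (∀ i, C (i + 1) = c i) →
      (∀ i < K + 1, ∀ j < K + 1, c i = c j → i = j) → (∀ i < K + 1, c i ≠ v) →
      (∀ i < K + 1, G.Adj (C i) (C (i + 1))) → G.degree (c K) = 1 →
      (∀ i, i + 1 < K + 1 → G.degree (c i) = 2) →
      ∀ i < K + 1, ∀ y, G.Adj (C (i + 1)) y → y = C i ∨ (i + 1 < K + 1 ∧ y = C (i + 2)) := by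
    intro c C K C0 CS inj hcv adj leaf deg i hi y hy
    by_cases hiK : i + 1 < K + 1
    · have := nb_two (x := C i) (y := C (i + 2)) (w := y) (by rw [CS]; exact deg i hiK)
        (adj i hi).symm (adj (i + 1) hiK) ?_ hy
      · rcases this with e | e
        · exact Or.inl e
        · exact Or.inr ⟨hiK, e⟩
      · intro e
        rcases i with _ | i
        · rw [C0, CS] at e
          exact hcv _ hiK e.symm
        · rw [CS, CS] at e
          have := inj _ (by omega) _ (by omega) e
          omega
    · have : i = K := by omega
      subst this
      exact Or.inl (nb_one (by rw [CS]; exact leaf) (adj i hi).symm hy)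
  have adjA : ∀ i < P + 1, G.Adj (A i) (A (i + 1)) := by
    intro i hi
    rcases i with _ | i
    · rw [A0, AS]; exact hva
    · rw [AS, AS]; exact ha_adj i hi
  have adjB : ∀ i < Q + 1, G.Adj (B i) (B (i + 1)) := by
    intro i hi
    rcases i with _ | i
    · rw [B0, BS]; exact hvb
    · rw [BS, BS]; exact hb_adj i hi
  have H : Surg G (P + 1) (Q + 1) v A B h :=
    { conn := hG.connected
      hp := by omega
      hq := by omega
      A0 := A0
      B0 := B0
      hA := by
        intro i hi
        rcases i with _ | i
        · rw [A0, hv0]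
        · exact (hh _).1 i hi (AS i)
      hB := fun j hj => (hh _).2.1 j hj (BS j)
      cov := by
        intro x
        simp only [AS, BS]
        exact (hh x).2.2
      adjA := adjA
      adjB := adjB
      nbA := nb a A P A0 AS ha_inj hav adjA ha_leaf ha_deg
      nbB := nb b B Q B0 BS hb_inj hbv adjB hb_leaf hb_deg }
  have e1 : b 0 = B 1 := (BS 0).symm
  have e2 : a P = A (P + 1) := (AS P).symm
  rw [e1, e2]
  refine ⟨H.weak hsum, fun h3 hn => ?_⟩
  exact H.strict' hG hsum (by rw [AS]; exact ha_leaf) (by rw [BS]; exact hb_leaf) h3 hn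
end

section
/- For every tree T on n vertices, the number of 2-matchings (induced matchings) in T is at most the number of 2-matchings in the path P_n, and equality holds if and only if T is isomorphic to P_n or to the star K_{1,3}. -/
open SimpleGraph Filter

namespace S13
section
open scoped Classical

variable {V : Type*}

def sq : ℕ → ℕ
  | 0 => 1
  | 1 => 1
  | 2 => 2
  | (k+3) => sq (k+2) + sq k

lemma sq_pos (n : ℕ) : 0 < sq n := by
  induction n using sq.induct <;> simp_all [sq]

lemma sq_succ_lt (n : ℕ) (h : 1 ≤ n) : sq n < sq (n+1) := by
  match n, h with
  | 1, _ => simp [sq]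
  | (k+2), _ => rw [sq.eq_4]; have := sq_pos k; omega

lemma sq_le_succ (n : ℕ) : sq n ≤ sq (n+1) := by
  rcases Nat.eq_zero_or_pos n with rfl | h
  · simp [sq]
  · exact (sq_succ_lt n h).le

lemma sq_mono : Monotone sq := monotone_nat_of_le_succ sq_le_succ

lemma sq_two (n : ℕ) : 2 * sq n ≤ sq (n+2) := by
  match n with
  | 0 => simp [sq]
  | 1 => simp [sq]
  | 2 => simp [sq]
  | (k+3) =>
    have h1 : sq (k+5) = sq (k+4) + sq (k+2) := by rw [sq.eq_4]
    have h2 : sq (k+4) = sq (k+3) + sq (k+1) := by rw [sq.eq_4]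
    have h3 : sq (k+3) = sq (k+2) + sq k := by rw [sq.eq_4]
    have := sq_mono (show k ≤ k+1 by omega)
    show 2 * sq (k+3) ≤ sq (k+5)
    omega

def Ind (G : SimpleGraph V) (S : Finset V) (M : Finset (Sym2 V)) : Prop :=
  (∀ e ∈ M, e ∈ G.edgeSet) ∧ (∀ e ∈ M, ∀ x ∈ e, x ∈ S) ∧
  ∀ e ∈ M, ∀ f ∈ M, e ≠ f → ∀ x ∈ e, ∀ y ∈ f, x ≠ y ∧ ¬ G.Adj x y

noncomputable def N (G : SimpleGraph V) (S : Finset V) : ℕ := Set.ncard {M | Ind G S M}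

lemma N_empty (G : SimpleGraph V) : N G ∅ = 1 := by
  have : {M | Ind G ∅ M} = {∅} := by
    ext M
    simp only [Set.mem_ofPred_eq, Set.mem_singleton_iff]
    constructor
    · rintro ⟨_, h, _⟩
      rw [Finset.eq_empty_iff_forall_notMem]
      intro e he
      induction e using Sym2.ind with
      | _ a b => simpa using h _ he a (by simp)
    · rintro rfl
      simp [Ind]
  rw [N, this, Set.ncard_singleton]

lemma N_iso (G : SimpleGraph V) (S : Finset V) (v : V)
    (h : ∀ x ∈ S, ¬ G.Adj v x) : N G S = N G (S.erase v) := by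
  unfold N
  congr 1
  ext M
  simp only [Set.mem_ofPred_eq, Ind]
  refine and_congr_right fun h1 => and_congr_left fun h2 => ?_
  constructor
  · intro h3 e he x hx
    rw [Finset.mem_erase]
    refine ⟨?_, h3 e he x hx⟩
    rintro rfl
    obtain ⟨y, rfl⟩ := Sym2.mem_iff_exists.1 hx
    exact h y (h3 _ he y (by simp)) (by simpa using h1 _ he)
  · intro h3 e he x hx
    exact Finset.mem_of_mem_erase (h3 e he x hx)

lemma N_leaf [Fintype V] (G : SimpleGraph V) (S : Finset V) (v u : V) (hv : v ∈ S) (hu : u ∈ S)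
    (huv : G.Adj v u) (h : ∀ x ∈ S, G.Adj v x → x = u) :
    N G S = N G (S.erase v) + N G (S.filter fun w => w ≠ u ∧ ¬ G.Adj u w) := by
  set T := S.filter fun w => w ≠ u ∧ ¬ G.Adj u w with hT
  have hT' : ∀ w, w ∈ T ↔ w ∈ S ∧ w ≠ u ∧ ¬ G.Adj u w := by simp [hT]
  have key : {M | Ind G S M} = {M | Ind G (S.erase v) M} ∪ (insert s(v,u)) '' {M | Ind G T M} := by
    ext M
    simp only [Set.mem_ofPred_eq, Set.mem_union, Set.mem_image]
    constructor
    · rintro ⟨h1, h2, h3⟩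
      by_cases he : s(v,u) ∈ M
      · right
        refine ⟨M.erase s(v,u), ⟨?_, ?_, ?_⟩, Finset.insert_erase he⟩
        · intro e he'
          exact h1 e (Finset.mem_of_mem_erase he')
        · intro e he' x hx
          have := h3 _ he e (Finset.mem_of_mem_erase he') (Finset.ne_of_mem_erase he').symm u (by simp) x hx
          rw [hT']
          exact ⟨h2 e (Finset.mem_of_mem_erase he') x hx, this.1.symm, this.2⟩
        · intro e he' f hf
          exact h3 e (Finset.mem_of_mem_erase he') f (Finset.mem_of_mem_erase hf)
      · left
        refine ⟨h1, ?_, h3⟩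
        intro e he' x hx
        rw [Finset.mem_erase]
        refine ⟨?_, h2 e he' x hx⟩
        rintro rfl
        obtain ⟨y, rfl⟩ := Sym2.mem_iff_exists.1 hx
        have := h y (h2 _ he' y (by simp)) (by simpa using h1 _ he')
        exact he (this ▸ he')
    · rintro (⟨h1, h2, h3⟩ | ⟨M, ⟨h1, h2, h3⟩, rfl⟩)
      · exact ⟨h1, fun e he x hx => Finset.mem_of_mem_erase (h2 e he x hx), h3⟩
      · have hc : ∀ f ∈ M, ∀ x ∈ s(v,u), ∀ y ∈ f, x ≠ y ∧ ¬ G.Adj x y := by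
          intro f hf x hx y hy
          have hy' := (hT' y).1 (h2 f hf y hy)
          rw [Sym2.mem_iff] at hx
          rcases hx with rfl | rfl
          · refine ⟨?_, fun h' => hy'.2.1 (h y hy'.1 h')⟩
            rintro rfl
            exact hy'.2.2 huv.symm
          · exact ⟨hy'.2.1.symm, hy'.2.2⟩
        refine ⟨?_, ?_, ?_⟩
        · intro e he
          rcases Finset.mem_insert.1 he with rfl | he
          · simpa using huv
          · exact h1 e he
        · intro e he x hx
          rcases Finset.mem_insert.1 he with rfl | he
          · rw [Sym2.mem_iff] at hx
            rcases hx with rfl | rfl <;> assumption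
          · exact ((hT' x).1 (h2 e he x hx)).1
        · intro e he f hf hef x hx y hy
          rcases Finset.mem_insert.1 he with rfl | he <;> rcases Finset.mem_insert.1 hf with rfl | hf
          · exact absurd rfl hef
          · exact hc f hf x hx y hy
          · have := hc e he y hy x hx
            exact ⟨this.1.symm, fun h' => this.2 h'.symm⟩
          · exact h3 e he f hf hef x hx y hy
  have hvT : v ∉ T := by
    rw [hT']
    exact fun h' => h'.2.2 huv.symm
  have hnot : ∀ M, Ind G T M → s(v,u) ∉ M := fun M hM hm => hvT (hM.2.1 _ hm v (by simp))
  unfold N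
  rw [key, Set.ncard_union_eq _ (Set.toFinite _) (Set.toFinite _), Set.ncard_image_of_injOn]
  · intro A hA B hB hAB
    have := congrArg (fun M => M.erase s(v,u)) hAB
    simpa [Finset.erase_insert (hnot A hA), Finset.erase_insert (hnot B hB)] using this
  · rw [Set.disjoint_left]
    rintro M hM ⟨M', _, rfl⟩
    have := hM.2.1 s(v,u) (by simp) v (by simp)
    simp at this

lemma bound [Fintype V] (G : SimpleGraph V)
    (H : ∀ S : Finset V, S.Nonempty → ∃ v ∈ S, ∀ x ∈ S, ∀ y ∈ S, G.Adj v x → G.Adj v y → x = y) :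
    ∀ n, ∀ S : Finset V, S.card = n → N G S ≤ sq n := by
  intro n
  induction n using Nat.strong_induction_on with
  | _ n ih =>
    intro S hS
    have ih' : ∀ T : Finset V, ∀ m, m < n → T.card ≤ m → N G T ≤ sq m := fun T m hm hT =>
      (ih T.card (by omega) T rfl).trans (sq_mono hT)
    rcases S.eq_empty_or_nonempty with rfl | hne
    · rw [N_empty]; exact sq_pos _
    obtain ⟨v, hv, h⟩ := H S hne
    have hpos : 0 < S.card := hne.card_pos
    have hcv := Finset.card_erase_of_mem hv
    by_cases hiso : ∀ x ∈ S, ¬ G.Adj v x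
    · rw [N_iso G S v hiso]
      exact (ih' _ (n-1) (by omega) (by omega)).trans (sq_mono (by omega))
    · push Not at hiso
      obtain ⟨u, hu, huv⟩ := hiso
      rw [N_leaf G S v u hv hu huv (fun x hx hvx => h x hx u hu hvx huv)]
      have hue : u ∈ S.erase v := Finset.mem_erase.2 ⟨huv.ne', hu⟩
      have hcu := Finset.card_erase_of_mem hue
      have hpos2 : 0 < (S.erase v).card := Finset.card_pos.2 ⟨u, hue⟩
      have hsub : (S.filter fun w => w ≠ u ∧ ¬ G.Adj u w) ⊆ (S.erase v).erase u := by
        intro w hw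
        simp only [Finset.mem_filter, Finset.mem_erase] at hw ⊢
        refine ⟨hw.2.1, ?_, hw.1⟩
        rintro rfl
        exact hw.2.2 huv.symm
      obtain ⟨k, rfl⟩ : ∃ k, n = k + 2 := ⟨n-2, by omega⟩
      by_cases hx : ∃ x ∈ S, x ≠ v ∧ G.Adj u x
      · obtain ⟨x, hx, hxv, hux⟩ := hx
        have hxe : x ∈ (S.erase v).erase u := by
          simp only [Finset.mem_erase]; exact ⟨hux.ne', hxv, hx⟩
        have hcx := Finset.card_erase_of_mem hxe
        have hpos3 : 0 < ((S.erase v).erase u).card := Finset.card_pos.2 ⟨x, hxe⟩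
        have hsub' : (S.filter fun w => w ≠ u ∧ ¬ G.Adj u w) ⊆ ((S.erase v).erase u).erase x := by
          intro w hw
          refine Finset.mem_erase.2 ⟨?_, hsub hw⟩
          rintro rfl
          simp only [Finset.mem_filter] at hw
          exact hw.2.2 hux
        have hc := Finset.card_le_card hsub'
        obtain ⟨m, rfl⟩ : ∃ m, k = m + 1 := ⟨k-1, by omega⟩
        show _ ≤ sq (m+3)
        rw [sq.eq_4]
        exact add_le_add (ih' _ _ (by omega) (by omega)) (ih' _ _ (by omega) (by omega))
      · push Not at hx
        have hc := Finset.card_le_card hsub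
        rw [N_iso G (S.erase v) u (fun x hx' => hx x (Finset.mem_of_mem_erase hx') (Finset.ne_of_mem_erase hx'))]
        have h1 := ih' ((S.erase v).erase u) k (by omega) (by omega)
        have h2 := ih' (S.filter fun w => w ≠ u ∧ ¬ G.Adj u w) k (by omega) (by omega)
        have := sq_two k
        omega

def PathOn (G : SimpleGraph V) (S : Finset V) (n : ℕ) (p : ℕ → V) : Prop :=
  (∀ i < n, p i ∈ S) ∧ (∀ x ∈ S, ∃ i < n, p i = x) ∧ (∀ i < n, ∀ j < n, p i = p j → i = j) ∧
  (∀ i < n, ∀ j < n, (G.Adj (p i) (p j) ↔ i + 1 = j ∨ j + 1 = i))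

lemma N_path [Fintype V] (G : SimpleGraph V) : ∀ n, ∀ S p, PathOn G S n p → N G S = sq n := by
  intro n
  induction n using Nat.strong_induction_on with
  | _ n ih =>
    rintro S p ⟨h1, h2, h3, h4⟩
    rcases Nat.eq_zero_or_pos n with rfl | hn
    · have : S = ∅ := by
        rw [Finset.eq_empty_iff_forall_notMem]
        intro x hx
        obtain ⟨i, hi, _⟩ := h2 x hx
        omega
      rw [this, N_empty]; simp [sq]
    have he : PathOn G (S.erase (p (n-1))) (n-1) p := by
      refine ⟨?_, ?_, ?_, ?_⟩
      · intro i hi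
        rw [Finset.mem_erase]
        refine ⟨fun h => ?_, h1 i (by omega)⟩
        have := h3 _ (by omega) _ (by omega) h
        omega
      · intro x hx
        obtain ⟨i, hi, rfl⟩ := h2 x (Finset.mem_of_mem_erase hx)
        refine ⟨i, ?_, rfl⟩
        have : i ≠ n-1 := by rintro rfl; simp at hx
        omega
      · intro i hi j hj; exact h3 i (by omega) j (by omega)
      · intro i hi j hj; exact h4 i (by omega) j (by omega)
    rcases (show n = 1 ∨ 2 ≤ n by omega) with rfl | hn2
    · rw [N_iso G S (p 0)]
      · rw [ih 0 (by omega) _ _ he]; simp [sq]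
      · intro x hx
        obtain ⟨i, hi, rfl⟩ := h2 x hx
        rw [h4 0 (by omega) i hi]; omega
    · have hf : PathOn G (S.filter fun w => w ≠ p (n-2) ∧ ¬ G.Adj (p (n-2)) w) (n-3) p := by
        refine ⟨?_, ?_, ?_, ?_⟩
        · intro i hi
          rw [Finset.mem_filter]
          refine ⟨h1 i (by omega), fun h => ?_, ?_⟩
          · have := h3 _ (by omega) _ (by omega) h
            omega
          · rw [h4 _ (by omega) _ (by omega)]; omega
        · intro x hx
          rw [Finset.mem_filter] at hx
          obtain ⟨hx, hx1, hx2⟩ := hx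
          obtain ⟨i, hi, rfl⟩ := h2 x hx
          refine ⟨i, ?_, rfl⟩
          rw [h4 _ (by omega) _ (by omega)] at hx2
          have : i ≠ n-2 := by rintro rfl; simp at hx1
          omega
        · intro i hi j hj; exact h3 i (by omega) j (by omega)
        · intro i hi j hj; exact h4 i (by omega) j (by omega)
      rw [N_leaf G S (p (n-1)) (p (n-2)) (h1 _ (by omega)) (h1 _ (by omega)),
        ih _ (by omega) _ _ he, ih _ (by omega) _ _ hf]
      · match n, hn2 with
        | 2, _ => simp [sq]
        | (k+3), _ => rw [sq.eq_4]; simp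
      · rw [h4 _ (by omega) _ (by omega)]; omega
      · intro x hx hadj
        obtain ⟨i, hi, rfl⟩ := h2 x hx
        rw [h4 _ (by omega) _ (by omega)] at hadj
        congr 1; omega

inductive TreeOn (G : SimpleGraph V) : Finset V → Prop
  | single (v : V) : TreeOn G {v}
  | leaf (S : Finset V) (v u : V) : TreeOn G S → v ∉ S → u ∈ S → G.Adj v u →
      (∀ x ∈ S, G.Adj v x → x = u) → TreeOn G (insert v S)

lemma TreeOn.hered {G : SimpleGraph V} {T : Finset V} (hT : TreeOn G T) :
    ∀ S ⊆ T, S.Nonempty → ∃ v ∈ S, ∀ x ∈ S, ∀ y ∈ S, G.Adj v x → G.Adj v y → x = y := by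
  induction hT with
  | single v =>
    intro S hS hne
    obtain ⟨w, hw⟩ := hne
    refine ⟨w, hw, fun x hx y hy _ _ => ?_⟩
    rw [Finset.mem_singleton.1 (hS hx), Finset.mem_singleton.1 (hS hy)]
  | leaf T v u hT hv hu huv h ih =>
    intro S hS hne
    by_cases hvS : v ∈ S
    · refine ⟨v, hvS, fun x hx y hy hvx hvy => ?_⟩
      rw [h x ((Finset.mem_insert.1 (hS hx)).resolve_left hvx.ne') hvx,
        h y ((Finset.mem_insert.1 (hS hy)).resolve_left hvy.ne') hvy]
    · exact ih S (fun x hx => (Finset.mem_insert.1 (hS hx)).resolve_left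
        (by rintro rfl; exact hvS hx)) hne

lemma TreeOn.conn {G : SimpleGraph V} {T : Finset V} (hT : TreeOn G T) :
    ∀ x ∈ T, ∀ y ∈ T, ∃ p : G.Walk x y, ∀ z ∈ p.support, z ∈ T := by
  induction hT with
  | single v =>
    intro x hx y hy
    obtain rfl := Finset.mem_singleton.1 hx
    obtain rfl := Finset.mem_singleton.1 hy
    exact ⟨.nil, by simp⟩
  | leaf T v u hT hv hu huv h ih =>
    intro x hx y hy
    rcases Finset.mem_insert.1 hx with rfl | hx' <;> rcases Finset.mem_insert.1 hy with rfl | hy'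
    · exact ⟨.nil, by simp⟩
    · obtain ⟨p, hp⟩ := ih u hu y hy'
      refine ⟨.cons huv p, ?_⟩
      simp only [Walk.support_cons, List.mem_cons, Finset.mem_insert]
      rintro z (rfl | hz)
      · simp
      · exact Or.inr (hp z hz)
    · obtain ⟨p, hp⟩ := ih u hu x hx'
      refine ⟨(Walk.cons huv p).reverse, ?_⟩
      simp only [Walk.support_reverse, List.mem_reverse, Walk.support_cons, List.mem_cons, Finset.mem_insert]
      rintro z (rfl | hz)
      · simp
      · exact Or.inr (hp z hz)
    · obtain ⟨p, hp⟩ := ih x hx' y hy'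
      exact ⟨p, fun z hz => Finset.mem_insert_of_mem (hp z hz)⟩

lemma TreeOn.nonempty {G : SimpleGraph V} {T : Finset V} (hT : TreeOn G T) : T.Nonempty := by
  cases hT <;> simp

lemma treeOn_univ [Fintype V] (G : SimpleGraph V) (hG : G.IsTree) : TreeOn G Finset.univ := by
  obtain ⟨r⟩ := hG.connected.nonempty
  obtain ⟨T, hT, hmax⟩ := Finset.exists_max_image (Finset.univ.filter (TreeOn G)) Finset.card
    ⟨{r}, by simpa using TreeOn.single r⟩
  simp only [Finset.mem_filter, Finset.mem_univ, true_and] at hT hmax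
  by_cases hu : T = Finset.univ
  · exact hu ▸ hT
  exfalso
  obtain ⟨a, ha⟩ := hT.nonempty
  obtain ⟨b, hb⟩ : ∃ b, b ∉ T := by
    by_contra! h
    exact hu (Finset.eq_univ_iff_forall.2 h)
  obtain ⟨p⟩ := hG.connected.preconnected a b
  obtain ⟨d, _, hd1, hd2⟩ := p.exists_boundary_dart (T : Set V) ha hb
  have hd1 : d.fst ∈ T := hd1
  have hd2 : d.snd ∉ T := hd2
  have := hmax _ (TreeOn.leaf T d.snd d.fst hT hd2 hd1 d.adj.symm (by
    intro x hx hadj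
    by_contra hne
    obtain ⟨q, hq⟩ := hT.conn x hx d.fst hd1
    have hq' : ∀ z ∈ q.bypass.support, z ∈ T := fun z hz => hq z (q.support_bypass_subset hz)
    have hp2 : (Walk.cons hadj.symm (Walk.cons d.adj.symm Walk.nil)).IsPath := by
      simp [Walk.cons_isPath_iff, d.adj.ne', hadj.ne', hne]
    have := hG.isAcyclic.path_unique ⟨q.bypass, q.bypass_isPath⟩ ⟨_, hp2⟩
    have h2 : q.bypass = _ := congrArg Subtype.val this
    apply hd2
    apply hq'
    rw [h2]
    simp))
  rw [Finset.card_insert_of_notMem hd2] at this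
  omega

def StarOn (G : SimpleGraph V) (S : Finset V) (c a b d : V) : Prop :=
  S = {c, a, b, d} ∧ c ≠ a ∧ c ≠ b ∧ c ≠ d ∧ a ≠ b ∧ a ≠ d ∧ b ≠ d ∧
  G.Adj c a ∧ G.Adj c b ∧ G.Adj c d ∧ ¬ G.Adj a b ∧ ¬ G.Adj a d ∧ ¬ G.Adj b d

lemma PathOn.card {G : SimpleGraph V} {S n p} (h : PathOn G S n p) : S.card = n := by
  have : S = (Finset.range n).image p := by
    ext x
    simp only [Finset.mem_image, Finset.mem_range]
    exact ⟨h.2.1 x, by rintro ⟨i, hi, rfl⟩; exact h.1 i hi⟩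
  rw [this, Finset.card_image_of_injOn, Finset.card_range]
  intro i hi j hj
  exact h.2.2.1 i (by simpa using hi) j (by simpa using hj)

lemma StarOn.card {G : SimpleGraph V} {S c a b d} (h : StarOn G S c a b d) : S.card = 4 := by
  obtain ⟨rfl, h⟩ := h
  rw [Finset.card_eq_succ]
  refine ⟨c, {a,b,d}, by grind, rfl, ?_⟩
  rw [Finset.card_eq_three]
  exact ⟨a, b, d, by grind⟩

lemma N_star [Fintype V] {G : SimpleGraph V} {S c a b d} (h : StarOn G S c a b d) : N G S = 4 := by
  obtain ⟨rfl, h⟩ := h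
  have hac := h.2.2.2.2.2.2.1.symm
  rw [N_leaf G _ a c (by simp) (by simp) hac (by
    have := G.irrefl (v := a)
    intro x hx hx'
    simp only [Finset.mem_insert, Finset.mem_singleton] at hx
    grind)]
  have h1 : Finset.filter (fun w => w ≠ c ∧ ¬ G.Adj c w) {c,a,b,d} = ∅ := by
    ext x
    simp only [Finset.mem_filter, Finset.mem_insert, Finset.mem_singleton, Finset.notMem_empty]
    grind
  have h2 : PathOn G (Finset.erase {c,a,b,d} a) 3 (fun i => if i = 0 then b else if i = 1 then c else d) := by
    have := G.irrefl (v := b)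
    have := G.irrefl (v := c)
    have := G.irrefl (v := d)
    have := G.adj_comm b c
    have := G.adj_comm b d
    have := G.adj_comm c d
    refine ⟨?_, ?_, ?_, ?_⟩
    · intro i hi
      interval_cases i <;> simp <;> grind
    · intro x hx
      simp only [Finset.mem_erase, Finset.mem_insert, Finset.mem_singleton] at hx
      have : x = b ∨ x = c ∨ x = d := by grind
      rcases this with rfl | rfl | rfl
      · exact ⟨0, by simp⟩
      · exact ⟨1, by simp⟩
      · exact ⟨2, by simp⟩
    · intro i hi j hj
      interval_cases i <;> interval_cases j <;> simp <;> grind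
    · intro i hi j hj
      interval_cases i <;> interval_cases j <;> simp <;> grind
  rw [h1, N_empty, N_path G _ _ _ h2]
  simp [sq]

lemma PathOn.rev {G : SimpleGraph V} {S n p} (h : PathOn G S n p) :
    PathOn G S n (fun i => p (n - 1 - i)) := by
  obtain ⟨h1, h2, h3, h4⟩ := h
  refine ⟨fun i hi => h1 _ (by omega), ?_, ?_, ?_⟩
  · intro x hx
    obtain ⟨i, hi, rfl⟩ := h2 x hx
    exact ⟨n-1-i, by omega, congrArg p (by omega)⟩
  · intro i hi j hj h
    have := h3 _ (by omega) _ (by omega) h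
    omega
  · intro i hi j hj
    rw [h4 _ (by omega) _ (by omega)]
    omega

lemma PathOn.extend {G : SimpleGraph V} {S n p} (h : PathOn G S (n+1) p) (v : V) (hv : v ∉ S)
    (hadj : G.Adj v (p n)) (hun : ∀ x ∈ S, G.Adj v x → x = p n) :
    PathOn G (insert v S) (n+2) (fun i => if i = n+1 then v else p i) := by
  obtain ⟨h1, h2, h3, h4⟩ := h
  have hvi : ∀ i < n+1, G.Adj v (p i) ↔ i = n := by
    intro i hi
    constructor
    · intro h
      exact h3 _ hi _ (by omega) (hun _ (h1 i hi) h)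
    · rintro rfl; exact hadj
  have hne : ∀ i < n+1, p i ≠ v := fun i hi h => hv (h ▸ h1 i hi)
  refine ⟨?_, ?_, ?_, ?_⟩
  · intro i hi
    by_cases h : i = n+1
    · simp [h]
    · simp only [h, if_false]; exact Finset.mem_insert_of_mem (h1 i (by omega))
  · intro x hx
    rcases Finset.mem_insert.1 hx with rfl | hx
    · exact ⟨n+1, by omega, by simp⟩
    · obtain ⟨i, hi, rfl⟩ := h2 x hx
      exact ⟨i, by omega, if_neg (by omega)⟩
  · intro i hi j hj
    by_cases h : i = n+1 <;> by_cases h' : j = n+1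
    · omega
    · simp only [h, h', if_true, if_false]
      exact fun e => absurd e.symm (hne j (by omega))
    · simp only [h, h', if_true, if_false]
      exact fun e => absurd e (hne i (by omega))
    · simp only [h, h', if_false]
      exact h3 i (by omega) j (by omega)
  · intro i hi j hj
    by_cases h : i = n+1 <;> by_cases h' : j = n+1
    · subst h; subst h'; simp
    · simp only [h, h', if_true, if_false]
      rw [hvi j (by omega)]; omega
    · simp only [h, h', if_true, if_false]
      rw [G.adj_comm, hvi i (by omega)]; omega
    · simp only [h, h', if_false]
      exact h4 i (by omega) j (by omega)

/-- Consequence of equality at a leaf. -/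
lemma eq_leaf [Fintype V] (G : SimpleGraph V)
    (hb : ∀ S : Finset V, N G S ≤ sq S.card)
    (S : Finset V) (hS : N G S = sq S.card) (v u : V) (hv : v ∈ S) (hu : u ∈ S)
    (huv : G.Adj v u) (h : ∀ x ∈ S, G.Adj v x → x = u) (x : V) (hx : x ∈ S) (hxv : x ≠ v)
    (hux : G.Adj u x) :
    N G (S.erase v) = sq (S.erase v).card ∧
    (5 ≤ S.card → ∀ y ∈ S, G.Adj u y → y = v ∨ y = x) := by
  rw [N_leaf G S v u hv hu huv h] at hS
  have hcv := Finset.card_erase_of_mem hv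
  have hsub : (S.filter fun w => w ≠ u ∧ ¬ G.Adj u w) ⊆ S \ {v, u, x} := by
    intro w hw
    simp only [Finset.mem_filter] at hw
    have := huv.symm
    simp only [Finset.mem_sdiff, Finset.mem_insert, Finset.mem_singleton]
    grind
  have h3 : ({v,u,x} : Finset V).card = 3 := Finset.card_eq_three.2 ⟨v, u, x, huv.ne, hxv.symm, hux.ne, rfl⟩
  have hss : ({v,u,x} : Finset V) ⊆ S := by
    intro w hw
    simp only [Finset.mem_insert, Finset.mem_singleton] at hw
    grind
  have h3' := Finset.card_le_card hss
  have hcs := Finset.card_sdiff_of_subset hss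
  have hc := Finset.card_le_card hsub
  obtain ⟨m, hm⟩ : ∃ m, S.card = m + 3 := ⟨S.card - 3, by omega⟩
  have b1 := hb (S.erase v)
  have b2 := hb (S.filter fun w => w ≠ u ∧ ¬ G.Adj u w)
  have b3 := sq_mono (show (S.filter fun w => w ≠ u ∧ ¬ G.Adj u w).card ≤ m by omega)
  rw [hm, sq.eq_4] at hS
  have e1 : (S.erase v).card = m + 2 := by omega
  rw [e1] at b1 ⊢
  refine ⟨by omega, fun h5 y hy huy => ?_⟩
  by_contra hcon
  push Not at hcon
  have hsub' : (S.filter fun w => w ≠ u ∧ ¬ G.Adj u w) ⊆ (S \ {v, u, x}).erase y := by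
    intro w hw
    refine Finset.mem_erase.2 ⟨?_, hsub hw⟩
    rintro rfl
    simp only [Finset.mem_filter] at hw
    exact hw.2.2 huy
  have hy' : y ∈ S \ {v,u,x} := by
    have := huy.ne'
    simp only [Finset.mem_sdiff, Finset.mem_insert, Finset.mem_singleton]
    grind
  have hc' := Finset.card_le_card hsub'
  rw [Finset.card_erase_of_mem hy'] at hc'
  have b4 := sq_mono (show (S.filter fun w => w ≠ u ∧ ¬ G.Adj u w).card ≤ m - 1 by omega)
  have b5 := sq_succ_lt (m-1) (by omega)
  rw [show m - 1 + 1 = m by omega] at b5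
  omega

lemma char [Fintype V] (G : SimpleGraph V)
    (hb : ∀ S : Finset V, N G S ≤ sq S.card) (S : Finset V) (hT : TreeOn G S) :
    N G S = sq S.card → (∃ p, PathOn G S S.card p) ∨ ∃ c a b d, StarOn G S c a b d := by
  induction hT with
  | single v =>
    intro _
    refine Or.inl ⟨fun _ => v, ?_⟩
    refine ⟨by simp, ?_, ?_, ?_⟩
    · intro x hx
      exact ⟨0, by simp, (Finset.mem_singleton.1 hx).symm⟩
    · simp
    · simp
  | leaf T v u hT hv hu huv h ih =>
    intro hN
    have hcard : (insert v T).card = T.card + 1 := Finset.card_insert_of_notMem hv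
    have hvu : v ≠ u := huv.ne
    by_cases h1 : ∃ x ∈ T, G.Adj u x
    swap
    · -- T = {u}
      push Not at h1
      have hTu : T = {u} := by
        ext y
        rw [Finset.mem_singleton]
        constructor
        · intro hy
          obtain ⟨p, hp⟩ := hT.conn u hu y hy
          cases p with
          | nil => rfl
          | cons hadj q =>
            exact absurd hadj (h1 _ (hp _ (by simp)))
        · rintro rfl; exact hu
      subst hTu
      left
      have hp : PathOn G {u} (0+1) (fun _ => u) := by
        refine ⟨by simp, ?_, ?_, ?_⟩
        · intro x hx
          exact ⟨0, by simp, (Finset.mem_singleton.1 hx).symm⟩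
        · intro i hi j hj; omega
        · intro i hi j hj; simp; omega
      rw [hcard]
      exact ⟨_, hp.extend v hv huv h⟩
    obtain ⟨x, hx, hux⟩ := h1
    have hxv : x ≠ v := by rintro rfl; exact hv hx
    have hvn : ∀ y ∈ insert v T, G.Adj v y → y = u := by
      intro y hy hadj
      exact h y ((Finset.mem_insert.1 hy).resolve_left hadj.ne') hadj
    obtain ⟨e1, e2⟩ := eq_leaf G hb (insert v T) hN v u (by simp) (by simp [hu]) huv hvn x
      (by simp [hx]) hxv hux
    rw [Finset.erase_insert hv] at e1
    rcases ih e1 with ⟨p, hp⟩ | ⟨c, a, b, d, hs⟩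
    · obtain ⟨i, hi, rfl⟩ := hp.2.1 u hu
      obtain ⟨m, hm⟩ : ∃ m, T.card = m + 1 := ⟨T.card - 1, by omega⟩
      rw [hm] at hp hi
      by_cases him : i = m
      · subst him
        rw [hcard, hm]
        exact Or.inl ⟨_, hp.extend v hv huv h⟩
      by_cases hi0 : i = 0
      · subst hi0
        rw [hcard, hm]
        refine Or.inl ⟨_, hp.rev.extend v hv ?_ ?_⟩
        · simpa using huv
        · simpa using h
      have hA := (hp.2.2.2 i hi (i+1) (by omega)).2 (by omega)
      have hB := (hp.2.2.2 i hi (i-1) (by omega)).2 (by omega)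
      have hAT := hp.1 (i+1) (by omega)
      have hBT := hp.1 (i-1) (by omega)
      have hABne : p (i+1) ≠ p (i-1) := fun e => by
        have := hp.2.2.1 _ (by omega) _ (by omega) e
        omega
      by_cases h5 : 5 ≤ (insert v T).card
      · exfalso
        have k1 := (e2 h5 _ (Finset.mem_insert_of_mem hAT) hA).resolve_left (by
          intro e; rw [e] at hAT; exact hv hAT)
        have k2 := (e2 h5 _ (Finset.mem_insert_of_mem hBT) hB).resolve_left (by
          intro e; rw [e] at hBT; exact hv hBT)
        exact hABne (k1.trans k2.symm)
      · right
        have hi1 : i = 1 := by omega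
        have hm2 : m = 2 := by omega
        subst hi1; subst hm2
        have hT3 : T = {p 1, p 0, p 2} := by
          ext y
          simp only [Finset.mem_insert, Finset.mem_singleton]
          constructor
          · intro hy
            obtain ⟨j, hj, rfl⟩ := hp.2.1 y hy
            interval_cases j <;> simp
          · rintro (rfl | rfl | rfl) <;> exact hp.1 _ (by omega)
        refine ⟨p 1, v, p 0, p 2, ?_, huv.ne', hB.ne, hA.ne, ?_, ?_, hABne.symm, huv.symm, hB, hA, ?_, ?_, ?_⟩
        · rw [hT3]; ext y; simp only [Finset.mem_insert, Finset.mem_singleton]; tauto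
        · rintro rfl; exact hv hBT
        · rintro rfl; exact hv hAT
        · intro h'; exact hB.ne' (h _ hBT h')
        · intro h'; exact hA.ne' (h _ hAT h')
        · rw [hp.2.2.2 0 (by omega) 2 (by omega)]; omega
    · exfalso
      have h5 : 5 ≤ (insert v T).card := by rw [hcard, hs.card]
      obtain ⟨hTe, hca, hcb, hcd, hab, had, hbd, aca, acb, acd, nab, nad, nbd⟩ := hs
      have aT : a ∈ T := by simp [hTe]
      have bT : b ∈ T := by simp [hTe]
      have cT : c ∈ T := by simp [hTe]
      have dT : d ∈ T := by simp [hTe]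
      have ne : ∀ y ∈ T, y ≠ v := by rintro y hy rfl; exact hv hy
      -- a leaf not adjacent to v
      have main : ∀ l m k, l ∈ T → m ∈ T → k ∈ T → l ≠ m → l ≠ k → m ≠ k → G.Adj c l → G.Adj c m →
          G.Adj c k → (∀ y ∈ T, G.Adj l y → y = c) → l ≠ u → False := by
        intro l m k hl hm hk hlm hlk hmk acl acm ack hl' hlu
        have := (eq_leaf G hb (insert v T) hN l c (by simp [hl]) (by simp [cT]) acl.symm (by
          intro y hy hly
          rcases Finset.mem_insert.1 hy with rfl | hy
          · exact absurd (h l hl hly.symm) hlu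
          · exact hl' y hy hly) m (by simp [hm]) hlm.symm acm).2 h5 k (by simp [hk]) ack
        grind
      have ia := G.irrefl (v := a)
      have ib := G.irrefl (v := b)
      have la : ∀ y ∈ T, G.Adj a y → y = c := by
        intro y hy hay
        rw [hTe] at hy
        simp only [Finset.mem_insert, Finset.mem_singleton] at hy
        grind
      have lb : ∀ y ∈ T, G.Adj b y → y = c := by
        intro y hy hay
        have := G.adj_comm a b
        rw [hTe] at hy
        simp only [Finset.mem_insert, Finset.mem_singleton] at hy
        grind
      by_cases hau : a = u
      · exact main b a d bT aT dT hab.symm hbd had acb aca acd lb (by rw [← hau]; exact hab.symm)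
      · exact main a b d aT bT dT hab had hbd aca acb acd la hau

lemma num_eq [Fintype V] (G : SimpleGraph V) (hG : G.Connected) :
    numRMatchings G 2 = N G Finset.univ := by
  unfold numRMatchings N
  rw [← Nat.card_coe_set_eq]
  apply Nat.card_congr
  apply Equiv.subtypeEquivRight
  intro M
  simp only [IsRMatching, Ind, Set.mem_ofPred_eq, Finset.mem_univ, implies_true, true_and]
  refine and_congr_right fun h1 => ?_
  refine forall₂_congr fun e he => forall₂_congr fun f hf => imp_congr_right fun hef => ?_
  unfold edgeDist
  have hne : {d : ℕ | ∃ u ∈ e, ∃ w ∈ f, G.dist u w = d}.Nonempty := by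
    induction e using Sym2.ind with
    | _ a b =>
      induction f using Sym2.ind with
      | _ c d => exact ⟨_, a, by simp, c, by simp, rfl⟩
  rw [le_csInf_iff (OrderBot.bddBelow _) hne]
  have hd : ∀ x y, 2 ≤ G.dist x y ↔ x ≠ y ∧ ¬ G.Adj x y := by
    intro x y
    rw [← SimpleGraph.dist_eq_one_iff_adj, ne_eq, ← hG.dist_eq_zero_iff]
    omega
  constructor
  · intro h x hx y hy
    exact (hd x y).1 (h _ ⟨x, hx, y, hy, rfl⟩)
  · rintro h _ ⟨x, hx, y, hy, rfl⟩
    exact (hd x y).2 (h x hx y hy)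

lemma pathOn_of_iso [Fintype V] (G : SimpleGraph V) (n : ℕ) (hn : 0 < n) (f : G ≃g pathGraph n) :
    ∃ p, PathOn G Finset.univ n p := by
  refine ⟨fun i => f.symm (if h : i < n then ⟨i, h⟩ else ⟨0, hn⟩), by simp, ?_, ?_, ?_⟩
  · intro x _
    exact ⟨f x, (f x).2, by simp⟩
  · intro i hi j hj
    simp [hi, hj]
  · intro i hi j hj
    rw [f.symm.map_adj_iff, pathGraph_adj]
    simp [hi, hj]

lemma iso_of_pathOn [Fintype V] (G : SimpleGraph V) (n : ℕ) (p) (h : PathOn G Finset.univ n p) :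
    Nonempty (G ≃g pathGraph n) := by
  obtain ⟨h1, h2, h3, h4⟩ := h
  refine ⟨RelIso.symm ⟨Equiv.ofBijective (fun i : Fin n => p i) ⟨?_, ?_⟩, ?_⟩⟩
  · intro i j hij
    exact Fin.ext (h3 _ i.2 _ j.2 hij)
  · intro x
    obtain ⟨i, hi, rfl⟩ := h2 x (by simp)
    exact ⟨⟨i, hi⟩, rfl⟩
  · intro i j
    rw [pathGraph_adj]
    exact h4 _ i.2 _ j.2

lemma starOn_of_iso [Fintype V] (G : SimpleGraph V) (f : G ≃g completeBipartiteGraph (Fin 1) (Fin 3)) :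
    ∃ c a b d, StarOn G Finset.univ c a b d := by
  refine ⟨f.symm (.inl 0), f.symm (.inr 0), f.symm (.inr 1), f.symm (.inr 2), ?_, ?_⟩
  · ext x
    simp only [Finset.mem_univ, Finset.mem_insert, Finset.mem_singleton, true_iff]
    obtain ⟨y, rfl⟩ := f.symm.surjective x
    simp only [EmbeddingLike.apply_eq_iff_eq]
    revert y; decide
  · simp [f.symm.map_adj_iff]

lemma iso_of_starOn [Fintype V] (G : SimpleGraph V) (c a b d) (h : StarOn G Finset.univ c a b d) :
    Nonempty (G ≃g completeBipartiteGraph (Fin 1) (Fin 3)) := by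
  obtain ⟨hT, hca, hcb, hcd, hab, had, hbd, aca, acb, acd, nab, nad, nbd⟩ := h
  have := aca.symm
  have := acb.symm
  have := acd.symm
  have nba : ¬ G.Adj b a := fun h => nab h.symm
  have nda : ¬ G.Adj d a := fun h => nad h.symm
  have ndb : ¬ G.Adj d b := fun h => nbd h.symm
  refine ⟨RelIso.symm ⟨Equiv.ofBijective (Sum.elim (fun _ : Fin 1 => c) ![a, b, d]) ⟨?_, ?_⟩, ?_⟩⟩
  · rintro (i | i) (j | j) <;> fin_cases i <;> fin_cases j <;> simp <;> grind
  · intro x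
    have hx : x ∈ ({c, a, b, d} : Finset V) := hT ▸ Finset.mem_univ x
    simp only [Finset.mem_insert, Finset.mem_singleton] at hx
    rcases hx with rfl | rfl | rfl | rfl
    · exact ⟨.inl 0, rfl⟩
    · exact ⟨.inr 0, rfl⟩
    · exact ⟨.inr 1, rfl⟩
    · exact ⟨.inr 2, rfl⟩
  · rintro (i | i) (j | j) <;> fin_cases i <;> fin_cases j <;> simp <;> assumption

lemma pathMatchings_eq (n : ℕ) (hn : 0 < n) : pathMatchings 2 n = sq n := by
  obtain ⟨m, rfl⟩ : ∃ m, n = m + 1 := ⟨n-1, by omega⟩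
  unfold pathMatchings
  rw [num_eq _ (pathGraph_connected m)]
  obtain ⟨p, hp⟩ := pathOn_of_iso (pathGraph (m+1)) (m+1) hn (RelIso.refl _)
  exact N_path _ _ _ _ hp

end
end S13

/-- Every tree on `n` vertices has at most as many induced matchings (`2`-matchings) as the
path `P_n`, with equality iff the tree is isomorphic to `P_n` or to the star `K_{1,3}`. -/
theorem stmt13 {V : Type*} [Fintype V] (G : SimpleGraph V) (hG : G.IsTree) :
    numRMatchings G 2 ≤ pathMatchings 2 (Fintype.card V) ∧
    (numRMatchings G 2 = pathMatchings 2 (Fintype.card V) ↔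
      Nonempty (G ≃g SimpleGraph.pathGraph (Fintype.card V)) ∨
      Nonempty (G ≃g completeBipartiteGraph (Fin 1) (Fin 3))) := by
  have hT := S13.treeOn_univ G hG
  have hn : 0 < Fintype.card V := by
    obtain ⟨r⟩ := hG.connected.nonempty
    exact Fintype.card_pos_iff.2 ⟨r⟩
  have hb : ∀ S : Finset V, S13.N G S ≤ S13.sq S.card := fun S =>
    S13.bound G (fun S hne => hT.hered S (Finset.subset_univ _) hne) _ S rfl
  rw [S13.pathMatchings_eq _ hn, S13.num_eq G hG.connected, ← Finset.card_univ]
  refine ⟨hb _, ?_, ?_⟩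
  · intro h
    rcases S13.char G hb _ hT h with ⟨p, hp⟩ | ⟨c, a, b, d, hs⟩
    · exact Or.inl (S13.iso_of_pathOn G _ p hp)
    · exact Or.inr (S13.iso_of_starOn G c a b d hs)
  · intro h
    rcases h with ⟨⟨f⟩⟩ | ⟨⟨f⟩⟩
    · obtain ⟨p, hp⟩ := S13.pathOn_of_iso G _ hn f
      exact S13.N_path G _ _ _ hp
    · obtain ⟨c, a, b, d, hs⟩ := S13.starOn_of_iso G f
      rw [S13.N_star hs, hs.card]
      simp [S13.sq]
end

section
/- For every integer r ≥ 2 there is a unique real number s > 0 satisfying r/2 + s = (s+1)·log(s+1), and as r → ∞ this s satisfies s + 1 = (1+o(1)) · r/(2 log r). Moreover, s < r for all r ≥ 2. -/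
open SimpleGraph Filter

lemma aux_mono {a b : ℝ} (ha : 1 ≤ a) (hab : a < b) :
    a * Real.log a - a < b * Real.log b - b := by
  have ha0 : 0 < a := by linarith
  have hb0 : 0 < b := by linarith
  have h1 : Real.log (a / b) < a / b - 1 :=
    Real.log_lt_sub_one_of_pos (by positivity) (by
      intro h
      rw [div_eq_one_iff_eq hb0.ne'] at h
      linarith)
  rw [Real.log_div ha0.ne' hb0.ne'] at h1
  have h2 : b * (Real.log a - Real.log b) < b * (a / b - 1) := by gcongr
  have h3 : b * (a / b - 1) = a - b := by field_simp
  have h4 : 0 ≤ (b - a) * Real.log a :=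
    mul_nonneg (by linarith) (Real.log_nonneg ha)
  nlinarith

lemma aux_big {x : ℝ} (hx : 2 ≤ x) : x / 2 + x < (x + 1) * Real.log (x + 1) := by
  have hx0 : 0 < x + 1 := by linarith
  have h3 : 1 < Real.log 3 := by
    rw [Real.lt_log_iff_exp_lt (by norm_num)]
    have := Real.exp_one_lt_d9
    linarith
  have h1 : Real.log (3 / (x + 1)) ≤ 3 / (x + 1) - 1 :=
    Real.log_le_sub_one_of_pos (by positivity)
  rw [Real.log_div (by norm_num) hx0.ne'] at h1
  have h2 : (x + 1) * (Real.log 3 - Real.log (x + 1)) ≤ (x + 1) * (3 / (x + 1) - 1) := by gcongr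
  have h4 : (x + 1) * (3 / (x + 1) - 1) = 3 - (x + 1) := by field_simp
  nlinarith

lemma aux_lim : Tendsto (fun t : ℝ =>
    t * (2 * Real.log (2 * (t * Real.log t - t + 1))) / (2 * (t * Real.log t - t + 1)))
    atTop (nhds 1) := by
  have hinv : Tendsto (fun t : ℝ => t⁻¹) atTop (nhds 0) := tendsto_inv_atTop_zero
  have hu : Tendsto (fun t : ℝ => Real.log t - 1 + t⁻¹) atTop atTop :=
    (tendsto_atTop_add_const_right _ (-1) Real.tendsto_log_atTop).atTop_add hinv
  have hl : Tendsto (fun u : ℝ => Real.log u / u) atTop (nhds 0) :=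
    Real.isLittleO_log_id_atTop.tendsto_div_nhds_zero
  have hA : Tendsto (fun t : ℝ => (1 - t⁻¹ + Real.log 2) * (Real.log t - 1 + t⁻¹)⁻¹) atTop
      (nhds ((1 - 0 + Real.log 2) * 0)) :=
    ((tendsto_const_nhds.sub hinv).add tendsto_const_nhds).mul (tendsto_inv_atTop_zero.comp hu)
  have hB := hl.comp hu
  have hC := (hA.add hB).const_add 1
  simp only [mul_zero, add_zero] at hC
  refine hC.congr' ?_
  filter_upwards [eventually_gt_atTop 0, hu.eventually_gt_atTop 0] with t ht hut
  have e : 2 * (t * Real.log t - t + 1) = t * (2 * (Real.log t - 1 + t⁻¹)) := by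
    field_simp
  have e2 : Real.log (t * (2 * (Real.log t - 1 + t⁻¹))) =
      Real.log t + (Real.log 2 + Real.log (Real.log t - 1 + t⁻¹)) := by
    rw [Real.log_mul ht.ne' (by positivity), Real.log_mul (by norm_num) hut.ne']
  rw [e, e2]
  simp only [Function.comp]
  set u := Real.log t - 1 + t⁻¹ with hudef
  have e3 : Real.log t = u + 1 - t⁻¹ := by rw [hudef]; ring
  rw [e3]
  generalize t⁻¹ = w
  field_simp
  ring

/-- For every integer `r ≥ 2` there is a unique `s > 0` with
`r/2 + s = (s+1)·log(s+1)`; moreover `s < r`, and as `r → ∞` one has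
`s + 1 = (1+o(1)) · r/(2 log r)`. -/
theorem stmt14 :
    (∀ r : ℕ, 2 ≤ r →
      ∃! s : ℝ, 0 < s ∧ (r : ℝ) / 2 + s = (s + 1) * Real.log (s + 1)) ∧
    (∀ r : ℕ, 2 ≤ r → ∀ s : ℝ, 0 < s →
      (r : ℝ) / 2 + s = (s + 1) * Real.log (s + 1) → s < r) ∧
    (∀ f : ℕ → ℝ,
      (∀ r : ℕ, 2 ≤ r → 0 < f r ∧ (r : ℝ) / 2 + f r = (f r + 1) * Real.log (f r + 1)) →
      Filter.Tendsto (fun r : ℕ => (f r + 1) * (2 * Real.log r) / r)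
        Filter.atTop (nhds 1)) := by
  refine ⟨?_, ?_, ?_⟩
  · intro r hr
    have hr' : (2 : ℝ) ≤ r := by exact_mod_cast hr
    have hbig := aux_big hr'
    have hc : ContinuousOn (fun s : ℝ => (s + 1) * Real.log (s + 1) - s) (Set.Icc 0 (r : ℝ)) := by
      refine ContinuousOn.sub (ContinuousOn.mul (by fun_prop) ?_) (by fun_prop)
      refine ContinuousOn.log (by fun_prop) ?_
      intro x hx
      have := hx.1
      linarith
    have hiv := intermediate_value_Icc (by linarith : (0 : ℝ) ≤ r) hc
    obtain ⟨s, hs, hse⟩ := hiv (show (r : ℝ) / 2 ∈ _ by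
      constructor
      · norm_num
        linarith
      · linarith)
    simp only at hse
    have hs0 : 0 < s := by
      rcases hs.1.eq_or_lt with h | h
      · rw [← h] at hse
        norm_num at hse
        linarith
      · exact h
    refine ⟨s, ⟨hs0, by linarith⟩, ?_⟩
    rintro y ⟨hy0, hy⟩
    rcases lt_trichotomy y s with h | h | h
    · have := aux_mono (by linarith : 1 ≤ y + 1) (by linarith : y + 1 < s + 1)
      linarith
    · exact h
    · have := aux_mono (by linarith : 1 ≤ s + 1) (by linarith : s + 1 < y + 1)
      linarith
  · intro r hr s hs hse
    have hr' : (2 : ℝ) ≤ r := by exact_mod_cast hr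
    have hbig := aux_big hr'
    by_contra! h
    rcases h.eq_or_lt with h | h
    · rw [h] at hbig hse
      linarith
    · have := aux_mono (by linarith : 1 ≤ (r : ℝ) + 1) (by linarith : (r : ℝ) + 1 < s + 1)
      linarith
  · intro f hf
    have ht : Tendsto (fun r : ℕ => f r + 1) atTop atTop := by
      have h1 : Tendsto (fun r : ℕ => Real.sqrt ((r : ℝ) / 2)) atTop atTop :=
        Real.tendsto_sqrt_atTop.comp
          (tendsto_natCast_atTop_atTop.atTop_div_const (by norm_num))
      refine tendsto_atTop_mono' _ ?_ h1
      filter_upwards [eventually_ge_atTop 2] with r hr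
      obtain ⟨h0, he⟩ := hf r hr
      have hl := Real.log_le_sub_one_of_pos (by linarith : 0 < f r + 1)
      refine Real.sqrt_le_iff.2 ⟨by linarith, ?_⟩
      nlinarith
    refine (aux_lim.comp ht).congr' ?_
    filter_upwards [eventually_ge_atTop 2] with r hr
    obtain ⟨h0, he⟩ := hf r hr
    have e : 2 * ((f r + 1) * Real.log (f r + 1) - (f r + 1) + 1) = (r : ℝ) := by linarith
    simp only [Function.comp, e]
end

section
/- Let r ≥ 2 be an integer, let s > 0 be the unique real number with r/2 + s = (s+1)·log(s+1), and let α_r = (s+1)^{1/(r/2+s)} = e^{1/(s+1)}. Then (e^{1/r} · α_r)^{r/2 + s/2 + 1} ≥ (e^{1/r} · α_r)^{r/2 + s/2} + 1. -/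
open SimpleGraph Filter

/-- With `s > 0` the unique real with `r/2 + s = (s+1)·log(s+1)` and `α_r = e^{1/(s+1)}`,
one has `(e^{1/r} α_r)^{r/2+s/2+1} ≥ (e^{1/r} α_r)^{r/2+s/2} + 1`. -/
theorem stmt15 (r : ℕ) (hr : 2 ≤ r) (s : ℝ) (hs : 0 < s)
    (heq : (r : ℝ) / 2 + s = (s + 1) * Real.log (s + 1)) :
    (Real.exp (1 / r) * Real.exp (1 / (s + 1))) ^ ((r : ℝ) / 2 + s / 2) + 1 ≤
      (Real.exp (1 / r) * Real.exp (1 / (s + 1))) ^ ((r : ℝ) / 2 + s / 2 + 1) := by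
  have hr0 : (0 : ℝ) < r := by
    have : 0 < r := by omega
    exact_mod_cast this
  have ht : 0 < s + 1 := by linarith
  rw [← Real.exp_add, ← Real.exp_mul, ← Real.exp_mul]
  set c : ℝ := 1 / r + 1 / (s + 1) with hc
  have h1 : Real.log (s + 1) ≤ c * ((r : ℝ) / 2 + s / 2) := by
    have e : c * ((r : ℝ) / 2 + s / 2)
        = Real.log (s + 1) + (s / (2 * r) + 1 / (2 * (s + 1))) := by
      have hL : Real.log (s + 1) = ((r : ℝ) / 2 + s) / (s + 1) := by
        rw [heq]; field_simp
      rw [hL, hc]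
      field_simp
      ring
    rw [e]
    have : 0 ≤ s / (2 * r) + 1 / (2 * (s + 1)) := by positivity
    linarith
  have h2 : s + 1 ≤ Real.exp (c * ((r : ℝ) / 2 + s / 2)) := by
    have := Real.exp_le_exp.mpr h1
    rwa [Real.exp_log ht] at this
  have h3 : c + 1 ≤ Real.exp c := Real.add_one_le_exp c
  have h4 : 1 / (s + 1) ≤ c := by
    have : 0 ≤ 1 / (r : ℝ) := by positivity
    linarith
  have h5 : (s + 1) * (1 / (s + 1)) = 1 := by field_simp
  have h6 : 0 ≤ 1 / (s + 1) := by positivity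
  have h7 : (s + 1) * (1 / (s + 1)) ≤
      Real.exp (c * ((r : ℝ) / 2 + s / 2)) * (Real.exp c - 1) :=
    mul_le_mul h2 (by linarith) h6 (Real.exp_pos _).le
  rw [mul_add c ((r : ℝ) / 2 + s / 2) 1, mul_one, Real.exp_add]
  linarith
end

section
/- Let r ≥ 2 be an integer, let s > 0 be the unique real number with r/2 + s = (s+1)·log(s+1), and let α_r = (s+1)^{1/(r/2+s)} = e^{1/(s+1)}. Then for every integer w with 0 ≤ w ≤ s, one has (e^{1/r} · α_r)^{r + w + 1} ≥ (e^{1/r} · α_r)^{r + w} + w. -/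
open SimpleGraph Filter

/-- With `s > 0` the unique real with `r/2 + s = (s+1)·log(s+1)` and `α_r = e^{1/(s+1)}`,
for every integer `w` with `0 ≤ w ≤ s` one has
`(e^{1/r} α_r)^{r+w+1} ≥ (e^{1/r} α_r)^{r+w} + w`. -/
theorem stmt16 (r : ℕ) (hr : 2 ≤ r) (s : ℝ) (hs : 0 < s)
    (heq : (r : ℝ) / 2 + s = (s + 1) * Real.log (s + 1))
    (w : ℕ) (hw : (w : ℝ) ≤ s) :
    (Real.exp (1 / r) * Real.exp (1 / (s + 1))) ^ (r + w) + (w : ℝ) ≤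
      (Real.exp (1 / r) * Real.exp (1 / (s + 1))) ^ (r + w + 1) := by
  have hr0 : (0 : ℝ) < r := by exact_mod_cast (by omega : 0 < r)
  have ht : 0 < s + 1 := by linarith
  have hw0 : (0 : ℝ) ≤ w := Nat.cast_nonneg w
  rw [← Real.exp_add]
  obtain ⟨x, hx⟩ : ∃ x : ℝ, x = 1 / (r : ℝ) + 1 / (s + 1) := ⟨_, rfl⟩
  rw [← hx]
  have htx : 1 ≤ (s + 1) * x := by
    have h1 : (s + 1) * x = (s + 1) / r + 1 := by rw [hx]; field_simp
    have h2 : 0 < (s + 1) / r := by positivity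
    linarith
  have hx0 : 0 < x := by rw [hx]; positivity
  have hpow : Real.exp x ^ (r + w) = (s + 1) ^ 2 * Real.exp (2 / (s + 1)) * Real.exp (w * x - 1) := by
    rw [← Real.exp_nat_mul]
    have h2 : (s + 1) ^ 2 = Real.exp (2 * Real.log (s + 1)) := by
      rw [two_mul, Real.exp_add, Real.exp_log ht, sq]
    rw [h2, ← Real.exp_add, ← Real.exp_add]
    congr 1
    have h3 : (r : ℝ) * x = 1 + r / (s + 1) := by rw [hx]; field_simp
    have h4 : (r : ℝ) / (s + 1) = 2 * Real.log (s + 1) - 2 + 2 / (s + 1) := by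
      field_simp
      linarith
    push_cast
    rw [add_mul, h3, h4]
    ring
  have hA : (s + 1) ^ 2 * (w * x) ≤ Real.exp x ^ (r + w) := by
    rw [hpow]
    have h5 : (w : ℝ) * x ≤ Real.exp (w * x - 1) := by
      have := Real.add_one_le_exp ((w : ℝ) * x - 1)
      linarith
    have h6 : 1 ≤ Real.exp (2 / (s + 1)) := Real.one_le_exp (by positivity)
    have h7 : (s + 1) ^ 2 ≤ (s + 1) ^ 2 * Real.exp (2 / (s + 1)) :=
      le_mul_of_one_le_right (by positivity) h6
    exact mul_le_mul h7 h5 (by positivity) (by positivity)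
  have hB : x ≤ Real.exp x - 1 := by
    have := Real.add_one_le_exp x
    linarith
  have hC : (s + 1) ^ 2 * (w * x) * x ≤ Real.exp x ^ (r + w) * (Real.exp x - 1) :=
    mul_le_mul hA hB hx0.le (by positivity)
  have hD : (w : ℝ) ≤ (s + 1) ^ 2 * (w * x) * x := by
    have h8 : 1 ≤ ((s + 1) * x) ^ 2 := one_le_pow₀ htx
    calc (w : ℝ) ≤ w * ((s + 1) * x) ^ 2 := le_mul_of_one_le_right hw0 h8
      _ = _ := by ring
  rw [pow_succ]
  linarith
end
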